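/- Under the hypotheses of the Multiple Deletion Theorem with basis θ_E, α₂η₂, …, α_qη_q, θ_{q+1}, …, θ_ℓ of D(𝒜), for any subset I ⊆ {2,…,q} with X_I := ∩_{i∈I} Hᵢ, the restricted arrangement 𝒜^{X_I} is free with basis given by the restrictions to X_I of θ_E, {αᵢηᵢ}_{i∉I, 2≤i≤q}, θ_{q+1}, …, θ_ℓ. -/

import Mathlib

open MvPolynomial Module

attribute [local instance] Classical.propDecidable

namespace ArrPaper

variable {K : Type*} [Field K] {ℓ m : ℕ}

/-- The polynomial coordinate ring `S = K[x₁,…,x_ℓ]`. -/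
abbrev S (K : Type*) [Field K] (ℓ : ℕ) := MvPolynomial (Fin ℓ) K

/-- A polynomial derivation of `S`, given by its values on the variables. -/
abbrev Deriv (K : Type*) [Field K] (ℓ : ℕ) := Fin ℓ → S K ℓ

/-- The linear form `∑ αᵢ xᵢ` as a polynomial. -/
noncomputable def lin (α : Fin ℓ → K) : S K ℓ := ∑ i, C (α i) * X i

/-- The value `θ(α)` of a derivation on a linear form `α`. -/
noncomputable def applyD (θ : Deriv K ℓ) (α : Fin ℓ → K) : S K ℓ := ∑ i, C (α i) * θ i

lemma applyD_add (θ η : Deriv K ℓ) (α : Fin ℓ → K) :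
    applyD (θ + η) α = applyD θ α + applyD η α := by
  simp [applyD, mul_add, Finset.sum_add_distrib]

lemma applyD_smul (f : S K ℓ) (θ : Deriv K ℓ) (α : Fin ℓ → K) :
    applyD (f • θ) α = f * applyD θ α := by
  simp only [applyD, Pi.smul_apply, smul_eq_mul, Finset.mul_sum]
  exact Finset.sum_congr rfl fun i _ => by ring

/-- The logarithmic derivation module `D(𝒜)` of an arrangement, where the
arrangement is specified by the finite set of its defining linear forms. -/
noncomputable def logDer (A : Finset (Fin ℓ → K)) : Submodule (S K ℓ) (Deriv K ℓ) where
  carrier := {θ | ∀ α ∈ A, lin α ∣ applyD θ α}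
  add_mem' := by
    intro a b ha hb α hα
    rw [applyD_add]
    exact dvd_add (ha α hα) (hb α hα)
  zero_mem' := by intro α hα; simp [applyD]
  smul_mem' := by
    intro f θ hθ β hβ
    rw [applyD_smul]
    exact (hθ β hβ).mul_left f

/-- The logarithmic derivation module `D(𝒜, m)` of a multiarrangement. -/
noncomputable def logDerM (A : Finset (Fin ℓ → K)) (mult : (Fin ℓ → K) → ℕ) :
    Submodule (S K ℓ) (Deriv K ℓ) where
  carrier := {θ | ∀ α ∈ A, (lin α) ^ (mult α) ∣ applyD θ α}
  add_mem' := by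
    intro a b ha hb α hα
    rw [applyD_add]
    exact dvd_add (ha α hα) (hb α hα)
  zero_mem' := by intro α hα; simp [applyD]
  smul_mem' := by
    intro f θ hθ β hβ
    rw [applyD_smul]
    exact (hθ β hβ).mul_left f

/-- The Euler derivation. -/
noncomputable def eulerD (K : Type*) [Field K] (ℓ : ℕ) : Deriv K ℓ := fun i => X i

/-- A derivation is homogeneous of degree `d` if all its coefficients are. -/
def IsHomog (θ : Deriv K ℓ) (d : ℕ) : Prop := ∀ i, (θ i).IsHomogeneous d

/-- A family is a (free) basis of a submodule of the derivation module. -/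
def IsBasisOf {ι : Type*} (θ : ι → Deriv K ℓ) (M : Submodule (S K ℓ) (Deriv K ℓ)) : Prop :=
  (∀ i, θ i ∈ M) ∧ LinearIndependent (S K ℓ) θ ∧ Submodule.span (S K ℓ) (Set.range θ) = M

/-- `𝒜` is free with exponents `d₁,…,d_ℓ`. -/
def IsFreeWithExp (A : Finset (Fin ℓ → K)) (d : Fin ℓ → ℕ) : Prop :=
  ∃ θ : Fin ℓ → Deriv K ℓ, IsBasisOf θ (logDer A) ∧ ∀ i, IsHomog (θ i) (d i)

/-- `(𝒜, m)` is free with exponents `d₁,…,d_ℓ`. -/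
def IsFreeWithExpM (A : Finset (Fin ℓ → K)) (mult : (Fin ℓ → K) → ℕ) (d : Fin ℓ → ℕ) : Prop :=
  ∃ θ : Fin ℓ → Deriv K ℓ, IsBasisOf θ (logDerM A mult) ∧ ∀ i, IsHomog (θ i) (d i)

/-- The hyperplane `ker α ⊆ Kˡ` attached to a linear form `α`. -/
noncomputable def hyp (α : Fin ℓ → K) : Submodule K (Fin ℓ → K) :=
  LinearMap.ker (∑ i, α i • LinearMap.proj i : (Fin ℓ → K) →ₗ[K] K)

/-- The restriction `𝒜^H = {H ∩ L : L ∈ 𝒜'}` of an arrangement `𝒜'` to the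
hyperplane `H = ker α_H`, as a finite set of subspaces. -/
noncomputable def restH (A' : Finset (Fin ℓ → K)) (αH : Fin ℓ → K) :
    Finset (Submodule K (Fin ℓ → K)) :=
  A'.image (fun β => hyp αH ⊓ hyp β)

/-- The restriction `𝒜^X = {X ∩ H : H ∈ 𝒜, X ⊄ H}` to a subspace `X`. -/
noncomputable def restArr (A : Finset (Fin ℓ → K)) (Xs : Submodule K (Fin ℓ → K)) :
    Finset (Submodule K (Fin ℓ → K)) :=
  (A.filter (fun β => ¬ Xs ≤ hyp β)).image (fun β => Xs ⊓ hyp β)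

/-- Codimension of a subspace of `Kˡ`. -/
noncomputable def codim (Xs : Submodule K (Fin ℓ → K)) : ℕ := ℓ - Module.finrank K Xs

/-- The intersection lattice `L(𝒜)`. -/
noncomputable def LSet (A : Finset (Fin ℓ → K)) : Finset (Submodule K (Fin ℓ → K)) :=
  A.powerset.image (fun b => b.inf hyp)

/-- Pullback (restriction) of polynomial functions along a linear map
`ι : Kᵐ → Kˡ`. -/
noncomputable def pullback (ι : (Fin m → K) →ₗ[K] (Fin ℓ → K)) : S K ℓ →ₐ[K] S K m :=
  aeval (fun j => ∑ i, C (ι (Pi.single i 1) j) * X i)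

/-- The (Euler) restriction of a derivation onto the subspace `im ι ≅ Kᵐ`,
computed using chosen linear forms `γ i` lifting the coordinates of `Kᵐ`. -/
noncomputable def restD (ι : (Fin m → K) →ₗ[K] (Fin ℓ → K)) (γ : Fin m → (Fin ℓ → K))
    (θ : Deriv K ℓ) : Deriv K m :=
  fun i => pullback ι (applyD θ (γ i))

/-- `γ` is a system of coordinate lifts for `ι : Kᵐ → Kˡ`. -/
def CoordLifts (ι : (Fin m → K) →ₗ[K] (Fin ℓ → K)) (γ : Fin m → (Fin ℓ → K)) : Prop :=
  ∀ i, pullback ι (lin (γ i)) = X i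

/-- `B` (a finite set of forms on `Kᵐ`) represents the restricted arrangement
`𝒜^X` via the embedding `ι : Kᵐ ≅ X ⊆ Kˡ`. -/
def Represents (B : Finset (Fin m → K)) (ι : (Fin m → K) →ₗ[K] (Fin ℓ → K))
    (A : Finset (Fin ℓ → K)) (Xs : Submodule K (Fin ℓ → K)) : Prop :=
  (∀ b ∈ B, b ≠ 0) ∧ B.image (fun b => (hyp b).map ι) = restArr A Xs ∧
    B.card = (restArr A Xs).card

/-- The restricted arrangement `𝒜^X` is free with exponents `e`. -/
def RestFree (A : Finset (Fin ℓ → K)) (Xs : Submodule K (Fin ℓ → K)) (m : ℕ)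
    (e : Fin m → ℕ) : Prop :=
  ∃ (φ : (Fin m → K) ≃ₗ[K] Xs) (B : Finset (Fin m → K)),
    Represents B (Xs.subtype ∘ₗ φ.toLinearMap) A Xs ∧ IsFreeWithExp B e

/-- The Ziegler multiplicity of a hyperplane `ker b ⊆ Kᵐ ≅ H` obtained by
restricting `𝒜` onto `H = ker α_H`. -/
noncomputable def zMult (A : Finset (Fin ℓ → K)) (αH : Fin ℓ → K)
    (ι : (Fin m → K) →ₗ[K] (Fin ℓ → K)) (b : Fin m → K) : ℕ :=
  ((A.erase αH).filter (fun β => hyp αH ⊓ hyp β = (hyp b).map ι)).card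

/-- `θ ↦ θ(α)` as an `S`-linear map. -/
noncomputable def applyDL (α : Fin ℓ → K) : Deriv K ℓ →ₗ[S K ℓ] S K ℓ where
  toFun θ := applyD θ α
  map_add' a b := applyD_add a b α
  map_smul' f θ := by simpa using applyD_smul f θ α

/-- `D_H(𝒜) = {θ ∈ D(𝒜) : θ(α_H) = 0}`. -/
noncomputable def DH (A : Finset (Fin ℓ → K)) (αH : Fin ℓ → K) :
    Submodule (S K ℓ) (Deriv K ℓ) :=
  logDer A ⊓ LinearMap.ker (applyDL αH)

end ArrPaper


namespace ArrPaper

variable {K : Type*} [Field K] {ℓ m : ℕ}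

lemma mem_hyp (α x : Fin ℓ → K) : x ∈ hyp α ↔ ∑ i, α i * x i = 0 := by
  simp [hyp, LinearMap.mem_ker, LinearMap.sum_apply]

lemma eval_lin (α x : Fin ℓ → K) : eval x (lin α) = ∑ i, α i * x i := by
  simp [lin]

lemma mem_hyp' (α x : Fin ℓ → K) : x ∈ hyp α ↔ eval x (lin α) = 0 := by
  rw [mem_hyp, eval_lin]

lemma lin_add (α β : Fin ℓ → K) : lin (α + β) = lin α + lin β := by
  simp [lin, add_mul, Finset.sum_add_distrib]

lemma lin_smul (c : K) (α : Fin ℓ → K) : lin (c • α) = C c * lin α := by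
  simp [lin, Finset.mul_sum, mul_assoc]

lemma lin_sub (α β : Fin ℓ → K) : lin (α - β) = lin α - lin β := by
  simp [lin, sub_mul, Finset.sum_sub_distrib]

lemma applyD_form_add (θ : Deriv K ℓ) (α β : Fin ℓ → K) :
    applyD θ (α + β) = applyD θ α + applyD θ β := by
  simp [applyD, add_mul, Finset.sum_add_distrib]

lemma applyD_form_smul (θ : Deriv K ℓ) (c : K) (α : Fin ℓ → K) :
    applyD θ (c • α) = C c * applyD θ α := by
  simp [applyD, Finset.mul_sum, mul_assoc]

lemma applyD_form_sub (θ : Deriv K ℓ) (α β : Fin ℓ → K) :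
    applyD θ (α - β) = applyD θ α - applyD θ β := by
  simp [applyD, sub_mul, Finset.sum_sub_distrib]

lemma applyD_euler (α : Fin ℓ → K) : applyD (eulerD K ℓ) α = lin α := rfl

lemma lin_homog (α : Fin ℓ → K) : (lin α).IsHomogeneous 1 :=
  IsHomogeneous.sum _ _ _ fun _ _ => isHomogeneous_C_mul_X _ _

lemma coeff_lin (α : Fin ℓ → K) (i : Fin ℓ) : coeff (Finsupp.single i 1) (lin α) = α i := by
  simp only [lin, coeff_sum, coeff_C_mul, coeff_X]
  rw [Finset.sum_eq_single i]
  · simp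
  · intro j _ hj
    rw [if_neg, mul_zero]
    intro h
    exact hj (Finsupp.single_left_injective one_ne_zero h)
  · simp

lemma lin_injective : Function.Injective (lin : (Fin ℓ → K) → S K ℓ) := by
  intro a b h
  ext i
  rw [← coeff_lin a, h, coeff_lin]

lemma lin_ne_zero {α : Fin ℓ → K} (h : α ≠ 0) : lin α ≠ 0 := by
  intro h0
  apply h
  apply lin_injective
  rw [h0]; simp [lin]

lemma lin_prime {α : Fin ℓ → K} (h : α ≠ 0) : Prime (lin α) := by
  apply Irreducible.prime
  apply irreducible_of_totalDegree_eq_one ((lin_homog α).totalDegree (lin_ne_zero h))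
  intro x hx
  obtain ⟨i, hi⟩ : ∃ i, α i ≠ 0 := by
    by_contra! hc
    exact h (funext hc)
  rw [isUnit_iff_ne_zero]
  rintro rfl
  have := hx (Finsupp.single i 1)
  rw [coeff_lin, zero_dvd_iff] at this
  exact hi this

/-- A linear form dividing another. -/
lemma eq_smul_of_lin_dvd {α β : Fin ℓ → K} (hβ : β ≠ 0) (h : lin α ∣ lin β) :
    ∃ c : K, c ≠ 0 ∧ β = c • α := by
  obtain ⟨f, hf⟩ := h
  have hb := lin_ne_zero hβ
  have hf0 : f ≠ 0 := by rintro rfl; simp at hf; exact hb hf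
  have ha0 : lin α ≠ 0 := by intro h; rw [h] at hf; simp at hf; exact hb hf
  have ht := totalDegree_mul_of_isDomain ha0 hf0
  rw [← hf, (lin_homog β).totalDegree hb, (lin_homog α).totalDegree ha0] at ht
  have : f.totalDegree = 0 := by omega
  rw [totalDegree_eq_zero_iff_eq_C] at this
  rw [this, mul_comm, ← lin_smul] at hf
  refine ⟨coeff 0 f, ?_, lin_injective hf⟩
  intro h0
  apply hf0
  rw [this, h0, map_zero]

lemma hyp_smul {c : K} (hc : c ≠ 0) (α : Fin ℓ → K) : hyp (c • α) = hyp α := by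
  ext x
  rw [mem_hyp', mem_hyp', lin_smul]
  simp [hc]

lemma hyp_eq_of_lin_dvd {α β : Fin ℓ → K} (hβ : β ≠ 0) (h : lin α ∣ lin β) : hyp α = hyp β := by
  obtain ⟨c, hc, rfl⟩ := eq_smul_of_lin_dvd hβ h
  rw [hyp_smul hc]

/-- equal hyperplanes imply proportional forms -/
lemma eq_smul_of_hyp_le {α β : Fin ℓ → K} (hβ : β ≠ 0) (h : hyp α ≤ hyp β) :
    ∃ c : K, c ≠ 0 ∧ β = c • α := by
  have := mem_span_of_iInf_ker_le_ker (𝕜 := K) (ι := Unit)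
    (L := fun _ => (∑ i, α i • LinearMap.proj i : (Fin ℓ → K) →ₗ[K] K))
    (K := (∑ i, β i • LinearMap.proj i : (Fin ℓ → K) →ₗ[K] K)) (by
      rw [iInf_const]; exact h)
  rw [Set.range_const, Submodule.mem_span_singleton] at this
  obtain ⟨c, hc⟩ := this
  have hb : β = c • α := by
    ext i
    have := congrArg (fun f => f (Pi.single i 1)) hc
    simp [LinearMap.sum_apply, Pi.single_apply] at this
    simp [this]
  refine ⟨c, ?_, hb⟩
  rintro rfl
  simp at hb
  exact hβ hb

lemma lin_dvd_of_hyp_le {α β : Fin ℓ → K} (h : hyp α ≤ hyp β) : lin α ∣ lin β := by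
  by_cases hβ : β = 0
  · subst hβ; simp [lin]
  obtain ⟨c, hc, rfl⟩ := eq_smul_of_hyp_le hβ h
  rw [lin_smul]
  exact dvd_mul_left _ _

/-- product of pairwise non-proportional linear forms divides -/
lemma prod_lin_dvd {ι : Type*} (s : Finset ι) (b : ι → Fin ℓ → K) (hb : ∀ i ∈ s, b i ≠ 0)
    (hinj : Set.InjOn (fun i => hyp (b i)) s) (f : S K ℓ) (h : ∀ i ∈ s, lin (b i) ∣ f) :
    ∏ i ∈ s, lin (b i) ∣ f := by
  apply Finset.prod_dvd_of_isRelPrime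
  · intro i hi j hj hij
    have hi' := lin_prime (hb i hi)
    apply (hi'.irreducible.isRelPrime_iff_not_dvd).2
    intro hd
    exact hij (hinj hi hj (hyp_eq_of_lin_dvd (hb j hj) hd))
  · exact h

/-- core determinant divisibility -/
lemma dvd_det_of_mulVec {R : Type*} [CommRing R] {n : ℕ} (N : Matrix (Fin n) (Fin n) R)
    (b : Fin n → R) (k : Fin n) (hk : IsUnit (b k)) (p : R) (h : ∀ i, p ∣ N.mulVec b i) :
    p ∣ N.det := by
  have h1 : N.det * b k = ∑ i, N.adjugate k i * N.mulVec b i := by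
    have : N.adjugate.mulVec (N.mulVec b) k = (N.det • b) k := by
      rw [Matrix.mulVec_mulVec, Matrix.adjugate_mul, Matrix.smul_mulVec, Matrix.one_mulVec]
    simpa [Matrix.mulVec, dotProduct] using this.symm
  have h2 : p ∣ N.det * b k := by
    rw [h1]
    exact Finset.dvd_sum fun i _ => (h i).mul_left _
  exact (hk.dvd_mul_right).1 h2

lemma exists_coord_ne {α : Fin ℓ → K} (h : α ≠ 0) : ∃ i, α i ≠ 0 := by
  by_contra! hc
  exact h (funext hc)

lemma lin_dvd_det {b : Fin m → K} (hb : b ≠ 0) (N : Matrix (Fin m) (Fin m) (S K m))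
    (h : ∀ i, lin b ∣ applyD (N i) b) : lin b ∣ N.det := by
  obtain ⟨k, hk⟩ := exists_coord_ne hb
  apply dvd_det_of_mulVec N (fun i => C (b i)) k
  · exact (isUnit_iff_ne_zero.2 hk).map C
  · intro i
    have : N.mulVec (fun i => C (b i)) i = applyD (N i) b := by
      simp [Matrix.mulVec, dotProduct, applyD, mul_comm]
    rw [this]; exact h i

lemma prod_dvd_det (B : Finset (Fin m → K)) (hB : ∀ b ∈ B, b ≠ 0) (hinj : Set.InjOn hyp (B : Set (Fin m → K)))
    (ρ : Fin m → Deriv K m) (hρ : ∀ i, ρ i ∈ logDer B) :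
    ∏ b ∈ B, lin b ∣ (Matrix.of ρ).det :=
  prod_lin_dvd B id hB hinj _ fun b hb => lin_dvd_det (hB b hb) _ fun i => hρ i b hb

/-- Saito-type criterion -/
lemma saito (B : Finset (Fin m → K)) (hB : ∀ b ∈ B, b ≠ 0) (hinj : Set.InjOn hyp (B : Set (Fin m → K)))
    (ρ : Fin m → Deriv K m) (hρ : ∀ i, ρ i ∈ logDer B)
    (hdet : (Matrix.of ρ).det ∣ ∏ b ∈ B, lin b) : IsBasisOf ρ (logDer B) := by
  have hQ : ∏ b ∈ B, lin b ≠ 0 := Finset.prod_ne_zero_iff.2 fun b hb => lin_ne_zero (hB b hb)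
  have hd0 : (Matrix.of ρ).det ≠ 0 := by
    intro h; rw [h, zero_dvd_iff] at hdet; exact hQ hdet
  refine ⟨hρ, ?_, ?_⟩
  · exact Matrix.linearIndependent_rows_of_det_ne_zero hd0
  · apply le_antisymm
    · rw [Submodule.span_le]
      rintro _ ⟨i, rfl⟩
      exact hρ i
    · intro ψ hψ
      set M := Matrix.of ρ with hM
      have hk : ∀ i, ∃ c, M.det * c = (M.updateRow i ψ).det := by
        intro i
        have : M.det ∣ (M.updateRow i ψ).det := by
          refine hdet.trans (prod_dvd_det B hB hinj (M.updateRow i ψ) ?_)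
          intro j
          by_cases hj : j = i
          · subst hj; rw [Matrix.updateRow_self]; exact hψ
          · rw [Matrix.updateRow_ne hj]; exact hρ j
        obtain ⟨c, hc⟩ := this
        exact ⟨c, hc.symm⟩
      choose c hc using hk
      have hsum : ψ = ∑ i, c i • ρ i := by
        have h1 : (Matrix.transpose M).mulVec (Matrix.cramer (Matrix.transpose M) ψ) = M.det • ψ := by
          rw [Matrix.mulVec_cramer, Matrix.det_transpose]
        ext1 k
        apply mul_left_cancel₀ hd0
        have h2 := congrFun h1 k
        rw [Pi.smul_apply, smul_eq_mul] at h2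
        rw [← h2, Finset.sum_apply, Finset.mul_sum]
        simp only [Matrix.mulVec, dotProduct, Matrix.cramer_transpose_apply, Matrix.transpose_apply]
        refine Finset.sum_congr rfl fun i _ => ?_
        rw [← hc i, Pi.smul_apply, smul_eq_mul]
        simp only [hM, Matrix.of_apply]
        ring
      rw [hsum]
      exact Submodule.sum_mem _ fun i _ => Submodule.smul_mem _ _ (Submodule.subset_span ⟨i, rfl⟩)


/-- pullback of a linear form -/
noncomputable def pb (ι : (Fin m → K) →ₗ[K] (Fin ℓ → K)) (β : Fin ℓ → K) : Fin m → K :=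
  fun i => ∑ j, β j * ι (Pi.single i 1) j

lemma pullback_lin (ι : (Fin m → K) →ₗ[K] (Fin ℓ → K)) (β : Fin ℓ → K) :
    pullback ι (lin β) = lin (pb ι β) := by
  simp only [pullback, lin, pb, map_sum, map_mul, aeval_X, algHom_C, Finset.mul_sum,
    algebraMap_eq, Finset.sum_mul]
  rw [Finset.sum_comm]
  refine Finset.sum_congr rfl fun i _ => Finset.sum_congr rfl fun j _ => by ring

lemma pb_dot (ι : (Fin m → K) →ₗ[K] (Fin ℓ → K)) (β : Fin ℓ → K) (v : Fin m → K) :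
    ∑ i, pb ι β i * v i = ∑ j, β j * ι v j := by
  have hv : ι v = ∑ i, v i • ι (Pi.single i 1) := by
    conv_lhs => rw [← Finset.univ_sum_single v]
    rw [map_sum]
    refine Finset.sum_congr rfl fun i _ => ?_
    rw [← map_smul]
    congr 1
    ext k
    by_cases h : k = i
    · subst h; simp
    · simp [Pi.single_eq_of_ne h]
  rw [hv]
  simp only [pb, Finset.sum_apply, Pi.smul_apply, smul_eq_mul, Finset.sum_mul, Finset.mul_sum]
  rw [Finset.sum_comm]
  refine Finset.sum_congr rfl fun i _ => Finset.sum_congr rfl fun j _ => by ring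

lemma mem_hyp_pb (ι : (Fin m → K) →ₗ[K] (Fin ℓ → K)) (β : Fin ℓ → K) (v : Fin m → K) :
    v ∈ hyp (pb ι β) ↔ ι v ∈ hyp β := by
  rw [mem_hyp, mem_hyp, pb_dot]

lemma coordLifts_dot {ι : (Fin m → K) →ₗ[K] (Fin ℓ → K)} {γ : Fin m → (Fin ℓ → K)}
    (h : CoordLifts ι γ) (i : Fin m) (v : Fin m → K) : ∑ j, γ i j * ι v j = v i := by
  have h1 := h i
  rw [pullback_lin] at h1
  rw [← pb_dot, ← eval_lin, h1, eval_X]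

lemma restD_add (ι : (Fin m → K) →ₗ[K] (Fin ℓ → K)) (γ : Fin m → (Fin ℓ → K))
    (θ η : Deriv K ℓ) : restD ι γ (θ + η) = restD ι γ θ + restD ι γ η := by
  ext1 i
  simp [restD, applyD_add]

lemma restD_smul (ι : (Fin m → K) →ₗ[K] (Fin ℓ → K)) (γ : Fin m → (Fin ℓ → K))
    (f : S K ℓ) (θ : Deriv K ℓ) : restD ι γ (f • θ) = pullback ι f • restD ι γ θ := by
  ext1 i
  simp [restD, applyD_smul]

lemma restD_zero (ι : (Fin m → K) →ₗ[K] (Fin ℓ → K)) (γ : Fin m → (Fin ℓ → K)) :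
    restD ι γ (0 : Deriv K ℓ) = 0 := by
  ext1 i
  simp [restD, applyD]

lemma restD_euler {ι : (Fin m → K) →ₗ[K] (Fin ℓ → K)} {γ : Fin m → (Fin ℓ → K)}
    (h : CoordLifts ι γ) : restD ι γ (eulerD K ℓ) = eulerD K m := by
  ext1 i
  simp only [restD, applyD_euler]
  exact h i

lemma det_dvd_det_of_span {ρ : Fin m → Deriv K m} {N : Fin m → Deriv K m}
    (h : ∀ i, N i ∈ Submodule.span (S K m) (Set.range ρ)) :
    (Matrix.of ρ).det ∣ (Matrix.of N).det := by
  have : ∀ i, ∃ c : Fin m → S K m, ∑ j, c j • ρ j = N i := fun i =>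
    (Submodule.mem_span_range_iff_exists_fun _).1 (h i)
  choose c hc using this
  have hN : Matrix.of N = Matrix.of c * Matrix.of ρ := by
    ext1 i k
    rw [Matrix.mul_apply, Matrix.of_apply, ← hc i]
    simp
  rw [hN, Matrix.det_mul]
  exact dvd_mul_left _ _

/-- constant-direction derivations in the restricted module -/
lemma const_mem_span {A : Finset (Fin ℓ → K)} {ι : (Fin m → K) →ₗ[K] (Fin ℓ → K)}
    {γ : Fin m → (Fin ℓ → K)} (hγ : CoordLifts ι γ) {ρ : Fin m → Deriv K m}
    (hspan : ∀ θ ∈ logDer A, restD ι γ θ ∈ Submodule.span (S K m) (Set.range ρ))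
    (T : Finset (Fin ℓ → K)) (v : Fin m → K)
    (hT : ∀ β ∈ A, β ∉ T → ∑ i, pb ι β i * v i = 0) :
    ((∏ β ∈ T, lin (pb ι β)) • (fun i => C (v i)) : Deriv K m) ∈
      Submodule.span (S K m) (Set.range ρ) := by
  have key : ∀ δ : Fin ℓ → K, applyD ((∏ β ∈ T, lin β) • (fun i => C (ι v i)) : Deriv K ℓ) δ
      = (∏ β ∈ T, lin β) * C (∑ j, δ j * ι v j) := by
    intro δ
    rw [applyD_smul]
    simp [applyD]
  have h1 := hspan ((∏ β ∈ T, lin β) • (fun i => C (ι v i))) (by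
    intro β hβ
    rw [key]
    by_cases h : β ∈ T
    · exact (Finset.dvd_prod_of_mem _ h).mul_right _
    · rw [← pb_dot, hT β hβ h]; simp)
  convert h1 using 1
  ext1 i
  simp only [restD, key, coordLifts_dot hγ]
  simp [map_prod, pullback_lin, algHom_C]

lemma det_updateRow_diagonal {R : Type*} [CommRing R] (a : R) (k : Fin m) (w : Fin m → R) :
    ((Matrix.diagonal (fun _ : Fin m => a)).updateRow k w).det = a ^ (m - 1) * w k := by
  rw [← Matrix.cramer_transpose_apply, Matrix.diagonal_transpose, Matrix.cramer_eq_adjugate_mulVec,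
    Matrix.adjugate_diagonal, Matrix.mulVec_diagonal]
  simp [Finset.card_erase_of_mem]

lemma det_dvd_prod {A : Finset (Fin ℓ → K)} {ι : (Fin m → K) →ₗ[K] (Fin ℓ → K)}
    {γ : Fin m → (Fin ℓ → K)} (hγ : CoordLifts ι γ) (B : Finset (Fin m → K))
    (hB : ∀ b ∈ B, b ≠ 0)
    (hcov : ∀ β ∈ A, pb ι β ≠ 0 → ∃ b ∈ B, hyp (pb ι β) = hyp b)
    {ρ : Fin m → Deriv K m}
    (hspan : ∀ θ ∈ logDer A, restD ι γ θ ∈ Submodule.span (S K m) (Set.range ρ)) :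
    (Matrix.of ρ).det ∣ ∏ b ∈ B, lin b := by
  have hmemE : eulerD K m ∈ Submodule.span (S K m) (Set.range ρ) := by
    rw [← restD_euler hγ]
    apply hspan
    intro α _
    rw [applyD_euler]
  -- the determinant divides a power of the product
  have h1 : ∃ N : ℕ, N ≠ 0 ∧ (Matrix.of ρ).det ∣ (∏ b ∈ B, lin b) ^ N := by
    set T := A.filter (fun β => pb ι β ≠ 0) with hT
    have hP : ∏ β ∈ T, lin (pb ι β) ∣ (∏ b ∈ B, lin b) ^ T.card := by
      rw [← Finset.prod_const]
      apply Finset.prod_dvd_prod_of_dvd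
      intro β hβ
      rw [hT, Finset.mem_filter] at hβ
      obtain ⟨b, hb, hbb⟩ := hcov β hβ.1 hβ.2
      exact (lin_dvd_of_hyp_le hbb.le).trans (Finset.dvd_prod_of_mem _ hb)
    have hd : (Matrix.of ρ).det ∣
        (Matrix.of (fun i : Fin m => ((∏ β ∈ T, lin (pb ι β)) •
          (fun j => C ((Pi.single i 1 : Fin m → K) j)) : Deriv K m))).det := by
      apply det_dvd_det_of_span
      intro i
      apply const_mem_span hγ hspan
      intro β hβ hβT
      have : pb ι β = 0 := by
        by_contra hc
        exact hβT (Finset.mem_filter.2 ⟨hβ, hc⟩)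
      simp [this]
    have he : Matrix.of (fun i : Fin m => ((∏ β ∈ T, lin (pb ι β)) •
          (fun j => C ((Pi.single i 1 : Fin m → K) j)) : Deriv K m)) =
          Matrix.diagonal (fun _ => ∏ β ∈ T, lin (pb ι β)) := by
      ext1 i j
      by_cases hij : j = i
      · subst hij; simp
      · rw [Matrix.diagonal_apply_ne _ (Ne.symm hij)]
        simp [Pi.single_eq_of_ne hij]
    rw [he, Matrix.det_diagonal, Finset.prod_const] at hd
    refine ⟨T.card * (Finset.univ : Finset (Fin m)).card + 1, by omega, hd.trans ?_⟩
    refine (pow_dvd_pow_of_dvd hP _).trans ?_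
    rw [← pow_mul]
    exact pow_dvd_pow _ (by omega)
  obtain ⟨N, hN, h1⟩ := h1
  have hQ : ∏ b ∈ B, lin b ≠ 0 := Finset.prod_ne_zero_iff.2 fun b hb => lin_ne_zero (hB b hb)
  have hd0 : (Matrix.of ρ).det ≠ 0 := by
    intro h
    rw [h, zero_dvd_iff] at h1
    exact hQ (pow_eq_zero_iff hN |>.1 h1)
  -- valuations
  have h2 : ∀ b ∈ B, ¬ (lin b * lin b ∣ (Matrix.of ρ).det) := by
    intro b hb hdvd
    have hb0 := hB b hb
    obtain ⟨k, hk⟩ := exists_coord_ne hb0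
    set T := A.filter (fun β => pb ι β ≠ 0 ∧ hyp (pb ι β) ≠ hyp b) with hT
    set P := ∏ β ∈ T, lin (pb ι β) with hPdef
    have hbP : ¬ lin b ∣ P := by
      intro h
      rw [hPdef, (lin_prime hb0).dvd_finsetProd_iff] at h
      obtain ⟨β, hβ, hβd⟩ := h
      rw [hT, Finset.mem_filter] at hβ
      exact hβ.2.2 (hyp_eq_of_lin_dvd hβ.2.1 hβd).symm
    set v : Fin m → Fin m → K := fun i => b k • Pi.single i 1 - b i • Pi.single k 1 with hv
    have hbv : ∀ i, ∑ j, b j * v i j = 0 := by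
      intro i
      simp [hv, mul_sub, Finset.sum_sub_distrib, Pi.single_apply]
      ring
    set N' : Fin m → Deriv K m := fun i => if i = k then eulerD K m else P • (fun j => C (v i j))
      with hN'
    have hd : (Matrix.of ρ).det ∣ (Matrix.of N').det := by
      apply det_dvd_det_of_span
      intro i
      by_cases hi : i = k
      · simp only [hN', if_pos hi]; exact hmemE
      · simp only [hN', if_neg hi]
        apply const_mem_span hγ hspan
        intro β hβ hβT
        by_cases h0 : pb ι β = 0
        · simp [h0]
        · have hh : hyp (pb ι β) = hyp b := by
            by_contra hc
            exact hβT (Finset.mem_filter.2 ⟨hβ, h0, hc⟩)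
          have : v i ∈ hyp (pb ι β) := by rw [hh, mem_hyp]; exact hbv i
          rwa [mem_hyp] at this
    set E : Matrix (Fin m) (Fin m) (S K m) := (1 : Matrix (Fin m) (Fin m) (S K m)).updateCol k
      (fun j => C (b j)) with hE
    have hNE : Matrix.of N' * E = (Matrix.diagonal (fun _ : Fin m => P * C (b k))).updateRow k
        (fun j => if j = k then lin b else X j) := by
      ext1 i j
      rw [Matrix.mul_apply]
      by_cases hj : j = k
      · subst hj
        simp only [hE, Matrix.updateCol_self, Matrix.of_apply]
        by_cases hi : i = j
        · subst hi
          simp [hN', Matrix.updateRow_self, lin, eulerD, mul_comm]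
        · rw [Matrix.updateRow_ne hi, Matrix.diagonal_apply_ne _ hi]
          simp only [hN', if_neg hi, Pi.smul_apply, smul_eq_mul]
          have := congrArg (C (σ := Fin m)) (hbv i)
          rw [map_sum, map_zero] at this
          calc ∑ x, P * C (v i x) * C (b x) = P * ∑ x, C (b x * v i x) := by
                rw [Finset.mul_sum]
                exact Finset.sum_congr rfl fun x _ => by rw [map_mul]; ring
            _ = 0 := by rw [this, mul_zero]
      · have hEj : ∀ x, E x j = (1 : Matrix (Fin m) (Fin m) (S K m)) x j := by
          intro x; rw [hE, Matrix.updateCol_ne hj]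
        simp only [hEj, Matrix.of_apply]
        rw [Finset.sum_eq_single j (by intro x _ hx; rw [Matrix.one_apply_ne hx, mul_zero]) (by simp),
          Matrix.one_apply_eq, mul_one]
        by_cases hi : i = k
        · subst hi
          simp [hN', Matrix.updateRow_self, eulerD, hj]
        · rw [Matrix.updateRow_ne hi]
          simp only [hN', if_neg hi, Pi.smul_apply, smul_eq_mul]
          by_cases hij : j = i
          · subst hij
            simp [hv, Pi.single_eq_of_ne hj]
          · rw [Matrix.diagonal_apply_ne _ (Ne.symm hij)]
            simp [hv, Pi.single_eq_of_ne hj, Pi.single_eq_of_ne hij]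
    have h3 : lin b * lin b ∣ (P * C (b k)) ^ (m - 1) * lin b := by
      have := congrArg Matrix.det hNE
      rw [Matrix.det_mul, det_updateRow_diagonal, if_pos rfl] at this
      rw [← this]
      exact (hdvd.trans hd).mul_right _
    have h4 : lin b ∣ (P * C (b k)) ^ (m - 1) :=
      (mul_dvd_mul_iff_right (lin_ne_zero hb0)).1 h3
    have h5 := (lin_prime hb0).dvd_of_dvd_pow h4
    have hu : IsUnit (C (b k) : S K m) := (isUnit_iff_ne_zero.2 hk).map C
    exact hbP ((hu.dvd_mul_right).1 h5)
  have hsq : Squarefree (Matrix.of ρ).det := by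
    rw [squarefree_iff_no_irreducibles hd0]
    intro p hp hpp
    have hpd : p ∣ (∏ b ∈ B, lin b) ^ N := (dvd_of_mul_right_dvd hpp).trans h1
    have hpp' := hp.prime
    have := hpp'.dvd_of_dvd_pow hpd
    rw [hpp'.dvd_finsetProd_iff] at this
    obtain ⟨b, hb, hpb⟩ := this
    have has : Associated p (lin b) := hp.associated_of_dvd (lin_prime (hB b hb)).irreducible hpb
    exact h2 b hb (((has.mul_mul has).dvd_iff_dvd_left).1 hpp)
  exact (hsq.dvd_pow_iff_dvd hN).1 h1


lemma hyp_inf_span (I : Finset ℕ) (α : ℕ → Fin ℓ → K) (δ : Fin ℓ → K)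
    (h : I.inf (fun j => hyp (α j)) ≤ hyp δ) : ∃ c : I → K, δ = ∑ i : I, c i • α i.1 := by
  have := mem_span_of_iInf_ker_le_ker (𝕜 := K) (ι := I)
    (L := fun j => (∑ i, α j.1 i • LinearMap.proj i : (Fin ℓ → K) →ₗ[K] K))
    (K := (∑ i, δ i • LinearMap.proj i : (Fin ℓ → K) →ₗ[K] K)) (by
      refine le_trans ?_ h
      rw [Finset.le_inf_iff]
      intro b hb
      exact iInf_le_of_le ⟨b, hb⟩ le_rfl)
  rw [Submodule.mem_span_range_iff_exists_fun] at this
  obtain ⟨c, hc⟩ := this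
  refine ⟨c, ?_⟩
  ext i
  have := congrArg (fun f => f (Pi.single i 1)) hc
  simp [LinearMap.sum_apply, Pi.single_apply] at this
  simp [this]

lemma applyD_sum (θ : Deriv K ℓ) {κ : Type*} (s : Finset κ) (c : κ → K) (a : κ → Fin ℓ → K) :
    applyD θ (∑ i ∈ s, c i • a i) = ∑ i ∈ s, C (c i) * applyD θ (a i) := by
  induction s using Finset.induction_on with
  | empty => simp [applyD]
  | insert i s hi ih => rw [Finset.sum_insert hi, Finset.sum_insert hi, applyD_form_add, ih,
      applyD_form_smul]

lemma pullback_lin_zero {ι : (Fin m → K) →ₗ[K] (Fin ℓ → K)} {δ : Fin ℓ → K}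
    (h : LinearMap.range ι ≤ hyp δ) : pb ι δ = 0 := by
  ext i
  have h1 : (Pi.single i 1 : Fin m → K) ∈ hyp (pb ι δ) := by
    rw [mem_hyp_pb]; exact h ⟨_, rfl⟩
  rw [mem_hyp] at h1
  simpa [Pi.single_apply] using h1

lemma pullback_vanish {A : Finset (Fin ℓ → K)} {I : Finset ℕ} {α : ℕ → Fin ℓ → K}
    (hI : ∀ i ∈ I, α i ∈ A) {ι : (Fin m → K) →ₗ[K] (Fin ℓ → K)}
    (hr : LinearMap.range ι = I.inf (fun j => hyp (α j))) {θ : Deriv K ℓ} (hθ : θ ∈ logDer A)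
    {δ : Fin ℓ → K} (h : LinearMap.range ι ≤ hyp δ) : pullback ι (applyD θ δ) = 0 := by
  obtain ⟨c, rfl⟩ := hyp_inf_span I α δ (hr ▸ h)
  rw [applyD_sum, map_sum]
  refine Finset.sum_eq_zero fun i _ => ?_
  obtain ⟨f, hf⟩ := hθ (α i.1) (hI i.1 i.2)
  have : pb ι (α i.1) = 0 := by
    apply pullback_lin_zero
    rw [hr]
    exact Finset.inf_le (f := fun j => hyp (α j)) i.2
  rw [hf, map_mul, map_mul, pullback_lin, this]
  simp [lin]

lemma applyD_restD (ι : (Fin m → K) →ₗ[K] (Fin ℓ → K)) (γ : Fin m → (Fin ℓ → K))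
    (θ : Deriv K ℓ) (b : Fin m → K) :
    applyD (restD ι γ θ) b = pullback ι (applyD θ (∑ i, b i • γ i)) := by
  rw [applyD_sum, map_sum]
  simp only [applyD, restD, map_mul, algHom_C, algebraMap_eq]

lemma isBasisOf_reindex {κ κ' : Type*} (e : κ ≃ κ') {θ : κ' → Deriv K ℓ}
    {M : Submodule (S K ℓ) (Deriv K ℓ)} (h : IsBasisOf (θ ∘ e) M) : IsBasisOf θ M := by
  obtain ⟨h1, h2, h3⟩ := h
  refine ⟨fun i => ?_, ?_, ?_⟩
  · have := h1 (e.symm i); simpa using this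
  · exact (linearIndependent_equiv e).1 h2
  · rw [← h3, e.surjective.range_comp]

lemma restr_main {A : Finset (Fin ℓ → K)} {I : Finset ℕ} {α : ℕ → Fin ℓ → K}
    (hI : ∀ i ∈ I, α i ∈ A) {ι : (Fin m → K) →ₗ[K] (Fin ℓ → K)}
    (hinj : Function.Injective ι)
    (hr : LinearMap.range ι = I.inf (fun j => hyp (α j)))
    {γ : Fin m → (Fin ℓ → K)} (hγ : CoordLifts ι γ) (B : Finset (Fin m → K))
    (hB : Represents B ι A (I.inf (fun j => hyp (α j))))
    {κ : Type*} [Fintype κ] (hκ : Fintype.card κ = m) (ξ : κ → Deriv K m)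
    (hξ : ∀ k, ∃ θ ∈ logDer A, ξ k = restD ι γ θ)
    (hspan : ∀ θ ∈ logDer A, restD ι γ θ ∈ Submodule.span (S K m) (Set.range ξ)) :
    IsBasisOf ξ (logDer B) := by
  obtain ⟨hB0, hBi, hBc⟩ := hB
  have hinjB : Set.InjOn (fun b => (hyp b).map ι) (B : Set (Fin m → K)) := by
    apply Finset.card_image_iff.1
    rw [hBi, hBc]
  have hinjB' : Set.InjOn hyp (B : Set (Fin m → K)) := by
    intro b hb b' hb' h
    exact hinjB hb hb' (by simp only [h])
  have hcmp : ∀ (β : Fin ℓ → K) (b : Fin m → K),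
      (hyp b).map ι = (I.inf (fun j => hyp (α j))) ⊓ hyp β → hyp (pb ι β) = hyp b := by
    intro β b h
    ext v
    rw [mem_hyp_pb]
    constructor
    · intro hv
      have : ι v ∈ (hyp b).map ι := by
        rw [h, ← hr]
        exact ⟨⟨v, rfl⟩, hv⟩
      obtain ⟨w, hw, hwv⟩ := this
      rwa [← hinj hwv]
    · intro hv
      have : ι v ∈ (hyp b).map ι := ⟨v, hv, rfl⟩
      rw [h] at this
      exact this.2
  have hcov : ∀ β ∈ A, pb ι β ≠ 0 → ∃ b ∈ B, hyp (pb ι β) = hyp b := by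
    intro β hβ h0
    have : (I.inf (fun j => hyp (α j))) ⊓ hyp β ∈ restArr A (I.inf (fun j => hyp (α j))) := by
      refine Finset.mem_image_of_mem _ (Finset.mem_filter.2 ⟨hβ, ?_⟩)
      intro hle
      rw [← hr] at hle
      exact h0 (pullback_lin_zero hle)
    rw [← hBi, Finset.mem_image] at this
    obtain ⟨b, hb, hbe⟩ := this
    exact ⟨b, hb, hcmp β b hbe⟩
  have hmem : ∀ θ ∈ logDer A, restD ι γ θ ∈ logDer B := by
    intro θ hθ b hb
    have : (hyp b).map ι ∈ restArr A (I.inf (fun j => hyp (α j))) := by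
      rw [← hBi]
      exact Finset.mem_image_of_mem _ hb
    obtain ⟨β, hβ, hβe⟩ := Finset.mem_image.1 this
    have hβA := (Finset.mem_filter.1 hβ).1
    have hh := hcmp β b hβe.symm
    obtain ⟨c, hc, rfl⟩ := eq_smul_of_hyp_le (hB0 b hb) hh.le
    rw [applyD_form_smul, lin_smul]
    refine mul_dvd_mul_left _ ?_
    rw [applyD_restD]
    have hz := pullback_vanish hI hr hθ (δ := β - ∑ i, pb ι β i • γ i) (by
      rintro _ ⟨v, rfl⟩
      rw [← mem_hyp_pb, mem_hyp, pb_dot]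
      simp only [Pi.sub_apply, sub_mul, Finset.sum_sub_distrib, Finset.sum_apply, Pi.smul_apply,
        smul_eq_mul, Finset.sum_mul]
      rw [Finset.sum_comm]
      simp only [mul_assoc, ← Finset.mul_sum, coordLifts_dot hγ]
      rw [pb_dot, sub_self])
    rw [applyD_form_sub, map_sub, sub_eq_zero] at hz
    rw [← hz, ← pullback_lin]
    exact map_dvd _ (hθ β hβA)
  have e : Fin m ≃ κ := (Fintype.equivFinOfCardEq hκ).symm
  apply isBasisOf_reindex e
  apply saito B hB0 hinjB'
  · intro i
    obtain ⟨θ, hθ, h⟩ := hξ (e i)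
    simp only [Function.comp_apply, h]
    exact hmem θ hθ
  · apply det_dvd_prod hγ B hB0 hcov
    intro θ hθ
    rw [e.surjective.range_comp]
    exact hspan θ hθ


lemma hc_mul {p f : S K ℓ} {r : ℕ} (hp : p.IsHomogeneous r) (n : ℕ) :
    homogeneousComponent n (p * f) = if r ≤ n then p * homogeneousComponent (n - r) f else 0 := by
  let _ := gradedAlgebra (σ := Fin ℓ) (R := K)
  have h := DirectSum.coe_decompose_mul_of_left_mem (homogeneousSubmodule (Fin ℓ) K) n
    (b := f) (show p ∈ homogeneousSubmodule (Fin ℓ) K r from hp)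
  have h1 : ∀ (g : S K ℓ) (i : ℕ), (DirectSum.decompose (homogeneousSubmodule (Fin ℓ) K) g i : S K ℓ)
      = homogeneousComponent i g := fun g i => decomposition.decompose'_apply g i
  rw [h1, h1] at h
  exact h

lemma homog_of_mul {p f : S K ℓ} {r N : ℕ} (hp : p.IsHomogeneous r) (hp0 : p ≠ 0)
    (h : (p * f).IsHomogeneous N) (hf : f ≠ 0) : ∃ s, s + r = N ∧ f.IsHomogeneous s := by
  have h1 : ∀ s, s + r ≠ N → homogeneousComponent s f = 0 := by
    intro s hs
    have h2 := hc_mul (f := f) hp (s + r)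
    rw [homogeneousComponent_of_mem h, if_neg hs, if_pos (by omega), Nat.add_sub_cancel] at h2
    exact (mul_eq_zero.1 h2.symm).resolve_left hp0
  by_cases hr : ∃ s, s + r = N
  · obtain ⟨s, hs⟩ := hr
    refine ⟨s, hs, ?_⟩
    have : f = homogeneousComponent s f := by
      conv_lhs => rw [← sum_homogeneousComponent f]
      by_cases hmem : s ∈ Finset.range (f.totalDegree + 1)
      · refine Finset.sum_eq_single_of_mem s hmem fun t _ hts => h1 t (by omega)
      · rw [homogeneousComponent_eq_zero s f (by simp at hmem; omega)]
        refine Finset.sum_eq_zero fun t ht => h1 t ?_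
        rintro h
        have : t = s := by omega
        exact hmem (this ▸ ht)
    rw [this]
    exact homogeneousComponent_isHomogeneous _ _
  · push Not at hr
    exfalso
    apply hf
    rw [← sum_homogeneousComponent f]
    exact Finset.sum_eq_zero fun t _ => h1 t (hr t)

lemma det_homog (M : Matrix (Fin m) (Fin m) (S K ℓ)) (e : Fin m → ℕ)
    (h : ∀ i j, (M i j).IsHomogeneous (e i)) : M.det.IsHomogeneous (∑ i, e i) := by
  rw [← Matrix.det_transpose, Matrix.det_apply]
  refine IsHomogeneous.sum _ _ _ fun σ _ => ?_
  have : (∏ i, M.transpose (σ i) i).IsHomogeneous (∑ i, e i) :=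
    IsHomogeneous.prod _ _ _ fun i _ => h i (σ i)
  rcases Int.units_eq_one_or (Equiv.Perm.sign σ) with hs | hs
  · rw [hs]; simpa using this
  · rw [hs]; simpa using this.neg

/-- projection onto polynomials killing `lin a` -/
noncomputable def proj (a : Fin ℓ → K) (k : Fin ℓ) : S K ℓ →ₐ[K] S K ℓ :=
  aeval (fun j => X j - if j = k then C (a k)⁻¹ * lin a else 0)

lemma proj_homog (a : Fin ℓ → K) (k : Fin ℓ) {f : S K ℓ} {n : ℕ} (h : f.IsHomogeneous n) :
    (proj a k f).IsHomogeneous n := by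
  have := h.aeval (S := K) (n := 1) (fun j => X j - if j = k then C (a k)⁻¹ * lin a else 0) (by
    intro j
    refine (isHomogeneous_X _ _).sub ?_
    split_ifs
    · exact (lin_homog a).C_mul _
    · exact isHomogeneous_zero _ _ _)
  rw [one_mul] at this
  exact this

lemma proj_lin (a : Fin ℓ → K) (k : Fin ℓ) (β : Fin ℓ → K) :
    proj a k (lin β) = lin (β - (β k * (a k)⁻¹) • a) := by
  rw [lin_sub, lin_smul]
  simp only [proj, lin, map_sum, map_mul, aeval_X, algHom_C, algebraMap_eq, mul_sub,
    Finset.sum_sub_distrib]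
  congr 1
  simp only [mul_ite, mul_zero, Finset.sum_ite_eq', Finset.mem_univ, if_true]
  ring

lemma proj_self {a : Fin ℓ → K} {k : Fin ℓ} (hk : a k ≠ 0) : proj a k (lin a) = 0 := by
  rw [proj_lin, mul_inv_cancel₀ hk, one_smul, sub_self]
  simp [lin]

lemma proj_dvd (a : Fin ℓ → K) (k : Fin ℓ) (f : S K ℓ) : lin a ∣ f - proj a k f := by
  rw [← Ideal.mem_span_singleton, ← Ideal.Quotient.eq]
  have : (Ideal.Quotient.mkₐ K (Ideal.span {lin a})) =
      (Ideal.Quotient.mkₐ K (Ideal.span {lin a})).comp (proj a k) := by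
    apply MvPolynomial.algHom_ext
    intro i
    simp only [AlgHom.comp_apply, proj, aeval_X, Ideal.Quotient.mkₐ_eq_mk]
    rw [Ideal.Quotient.eq, Ideal.mem_span_singleton]
    split_ifs
    · simp
    · simp
  exact DFunLike.congr_fun this f

lemma proj_proj {a : Fin ℓ → K} {k : Fin ℓ} (hk : a k ≠ 0) (f : S K ℓ) :
    proj a k (proj a k f) = proj a k f := by
  have h := map_dvd (proj a k) (proj_dvd a k f)
  rw [proj_self hk, zero_dvd_iff, map_sub, sub_eq_zero] at h
  exact h.symm

lemma dvd_of_proj_eq_zero {a : Fin ℓ → K} {k : Fin ℓ} {f : S K ℓ}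
    (h : proj a k f = 0) : lin a ∣ f := by
  have := proj_dvd a k f
  rwa [h, sub_zero] at this

lemma eval_proj {a : Fin ℓ → K} {k : Fin ℓ} {x : Fin ℓ → K} (hx : eval x (lin a) = 0)
    (f : S K ℓ) : eval x (proj a k f) = eval x f := by
  obtain ⟨g, hg⟩ := proj_dvd a k f
  have := congrArg (eval x) hg
  rw [map_sub, map_mul, hx, zero_mul, sub_eq_zero] at this
  exact this.symm

lemma pb_id (β : Fin ℓ → K) : pb LinearMap.id β = β := by
  ext i
  simp [pb, Pi.single_apply]

lemma coordLifts_id : CoordLifts (LinearMap.id : (Fin ℓ → K) →ₗ[K] (Fin ℓ → K))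
    (fun i => Pi.single i 1) := by
  intro i
  rw [pullback_lin, pb_id]
  simp [lin, Pi.single_apply]

lemma pullback_id (f : S K ℓ) :
    pullback (LinearMap.id : (Fin ℓ → K) →ₗ[K] (Fin ℓ → K)) f = f := by
  have : pullback (LinearMap.id : (Fin ℓ → K) →ₗ[K] (Fin ℓ → K)) = AlgHom.id K (S K ℓ) := by
    apply MvPolynomial.algHom_ext
    intro i
    simp [pullback, Pi.single_apply]
  rw [this]; rfl

lemma restD_id (θ : Deriv K ℓ) :
    restD (LinearMap.id : (Fin ℓ → K) →ₗ[K] (Fin ℓ → K)) (fun i => Pi.single i 1) θ = θ := by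
  ext1 i
  simp [restD, pullback_id, applyD, Pi.single_apply]

lemma basis_det_dvd {A0 : Finset (Fin ℓ → K)} (hA0 : ∀ β ∈ A0, β ≠ 0)
    {θ : Fin ℓ → Deriv K ℓ} (hθ : IsBasisOf θ (logDer A0)) :
    (Matrix.of θ).det ∣ ∏ β ∈ A0, lin β := by
  apply det_dvd_prod (A := A0) coordLifts_id A0 hA0
  · intro β hβ _
    exact ⟨β, hβ, by rw [pb_id]⟩
  · intro ψ hψ
    rw [restD_id, hθ.2.2]
    exact hψ

lemma applyD_sum_smul {κ : Type*} (s : Finset κ) (c : κ → S K ℓ) (θ : κ → Deriv K ℓ)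
    (α : Fin ℓ → K) : applyD (∑ i ∈ s, c i • θ i) α = ∑ i ∈ s, c i * applyD (θ i) α := by
  have := map_sum (applyDL α) (fun i => c i • θ i) s
  change applyD (∑ i ∈ s, c i • θ i) α = ∑ i ∈ s, applyD (c i • θ i) α at this
  rw [this]
  exact Finset.sum_congr rfl fun i _ => applyD_smul _ _ _

lemma hyp_inf_proj (a : Fin ℓ → K) (c : K) (β : Fin ℓ → K) :
    hyp a ⊓ hyp (β - c • a) = hyp a ⊓ hyp β := by
  ext x
  simp only [Submodule.mem_inf, mem_hyp', lin_sub, lin_smul, map_sub, map_mul]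
  constructor
  · rintro ⟨h1, h2⟩; refine ⟨h1, ?_⟩; rw [h1] at h2; simpa using h2
  · rintro ⟨h1, h2⟩; refine ⟨h1, ?_⟩; rw [h1, h2]; simp

lemma step {A0 R : Finset (Fin ℓ → K)} {a : Fin ℓ → K} (hA0 : ∀ β ∈ A0, β ≠ 0)
    (hinj : Set.InjOn hyp (A0 : Set (Fin ℓ → K))) (ha : a ∈ A0) (hR : R ⊆ A0.erase a)
    (hRinj : Set.InjOn (fun β => hyp a ⊓ hyp β) (R : Set (Fin ℓ → K)))
    {θ : Fin ℓ → Deriv K ℓ} (hθ : IsBasisOf θ (logDer A0)) {e : Fin ℓ → ℕ}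
    (he : ∀ i, IsHomog (θ i) (e i)) {x : Fin ℓ → K} (hxa : eval x (lin a) = 0)
    (hx : ∀ β ∈ (A0.erase a) \ R, eval x (lin β) ≠ 0) :
    ∃ (φ : Deriv K ℓ) (c : Fin ℓ → S K ℓ),
      lin a • φ = ∑ i, c i • θ i ∧
      (∀ i, c i ≠ 0 → ∃ s, (c i).IsHomogeneous s ∧ s + e i + R.card = ∑ j, e j) ∧
      ∑ j, e j ≤ A0.card ∧ φ ∈ logDer (A0.erase a) ∧ eval x (applyD φ a) ≠ 0 := by
  have ha0 := hA0 a ha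
  obtain ⟨k, hk⟩ := exists_coord_ne ha0
  have hQ : ∏ b ∈ A0, lin b ≠ 0 := Finset.prod_ne_zero_iff.2 fun b hb => lin_ne_zero (hA0 b hb)
  have hQh : (∏ b ∈ A0, lin b).IsHomogeneous A0.card := by
    have := IsHomogeneous.prod A0 (fun b => lin b) (fun _ => 1) (fun b _ => lin_homog b)
    simpa using this
  set M := Matrix.of θ with hM
  have hdet := basis_det_dvd hA0 hθ
  obtain ⟨E, hE⟩ := hdet
  have hd0 : M.det ≠ 0 := by
    intro h; rw [h, zero_mul] at hE; exact hQ hE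
  have hE0 : E ≠ 0 := by
    intro h; rw [h, mul_zero] at hE; exact hQ hE
  have hdh : M.det.IsHomogeneous (∑ j, e j) := det_homog M e fun i j => he i j
  have hD : ∑ j, e j ≤ A0.card := by
    rw [hE] at hQh
    obtain ⟨s, hs, -⟩ := homog_of_mul hdh hd0 hQh hE0
    omega
  -- logarithmic quotients
  have hg : ∀ i, ∃ g, applyD (θ i) a = lin a * g := fun i => hθ.1 i a ha
  choose g hg using hg
  -- adjugate row
  have hadj : ∀ j, ∑ i, M.adjugate k i * θ i j = if j = k then M.det else 0 := by
    intro j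
    have := congrFun (congrFun (Matrix.adjugate_mul M) k) j
    rw [Matrix.mul_apply] at this
    rw [hM] at this ⊢
    simp only [Matrix.of_apply] at this
    rw [this]
    by_cases hj : j = k
    · subst hj; simp
    · rw [if_neg hj, Matrix.smul_apply, Matrix.one_apply_ne (Ne.symm hj), smul_zero]
  have hadja : (∑ i, M.adjugate k i * g i) * lin a = C (a k) * M.det := by
    have : ∑ i, M.adjugate k i * applyD (θ i) a = C (a k) * M.det := by
      simp only [applyD, Finset.mul_sum]
      rw [Finset.sum_comm]
      calc ∑ j, ∑ i, M.adjugate k i * (C (a j) * θ i j)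
          = ∑ j, C (a j) * ∑ i, M.adjugate k i * θ i j := by
            refine Finset.sum_congr rfl fun j _ => ?_
            rw [Finset.mul_sum]
            exact Finset.sum_congr rfl fun i _ => by ring
        _ = _ := by simp [hadj]
    rw [← this, Finset.sum_mul]
    refine Finset.sum_congr rfl fun i _ => ?_
    rw [hg i]; ring
  have hadet : lin a ∣ M.det := by
    have hu : IsUnit (C (a k) : S K ℓ) := (isUnit_iff_ne_zero.2 hk).map C
    rw [← hu.dvd_mul_left, ← hadja]
    exact dvd_mul_left _ _
  -- projected forms
  set pf : (Fin ℓ → K) → (Fin ℓ → K) := fun β => β - (β k * (a k)⁻¹) • a with hpf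
  have hpfk : ∀ β, pf β k = 0 := by
    intro β
    simp [hpf, hk]
  have hpf0 : ∀ β ∈ R, pf β ≠ 0 := by
    intro β hβ h0
    have hβ' := Finset.mem_erase.1 (hR hβ)
    apply hβ'.1
    apply hinj hβ'.2 ha
    have h1 : lin β = C (β k * (a k)⁻¹) * lin a := by
      rw [← lin_smul]; congr 1; exact sub_eq_zero.1 h0
    exact (hyp_eq_of_lin_dvd (hA0 β hβ'.2) (h1 ▸ dvd_mul_left _ _)).symm
  have hpfinj : Set.InjOn (fun β => hyp (pf β)) (R : Set (Fin ℓ → K)) := by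
    intro β hβ β' hβ' h
    apply hRinj hβ hβ'
    simp only at h ⊢
    rw [← hyp_inf_proj a (β k * (a k)⁻¹) β, ← hyp_inf_proj a (β' k * (a k)⁻¹) β']
    change hyp a ⊓ hyp (pf β) = hyp a ⊓ hyp (pf β')
    rw [h]
  have hpr : proj a k (∏ β ∈ R, lin β) = ∏ β ∈ R, lin (pf β) := by
    rw [map_prod]
    exact Finset.prod_congr rfl fun β _ => proj_lin a k β
  set QR := ∏ β ∈ R, lin (pf β) with hQR
  have hQR0 : QR ≠ 0 := Finset.prod_ne_zero_iff.2 fun b hb => lin_ne_zero (hpf0 b hb)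
  have hQRh : QR.IsHomogeneous R.card := by
    have := IsHomogeneous.prod R (fun b => lin (pf b)) (fun _ => 1) (fun b _ => lin_homog _)
    simpa using this
  have hdiv : ∀ i, ∃ c, proj a k (M.adjugate k i) = QR * c := by
    intro i
    apply prod_lin_dvd R pf hpf0 hpfinj
    intro β hβ
    have hβ' := Finset.mem_erase.1 (hR hβ)
    rw [Matrix.adjugate_apply, AlgHom.map_det]
    apply lin_dvd_det (hpf0 β hβ)
    intro j
    have hap : ∀ w : Deriv K ℓ, applyD (fun t => proj a k (w t)) (pf β)
        = proj a k (applyD w (pf β)) := by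
      intro w
      simp [applyD, algHom_C]
    by_cases hj : j = i
    · subst hj
      have : applyD ((proj a k).mapMatrix (M.updateRow j (Pi.single k 1)) j) (pf β) = 0 := by
        simp only [applyD, AlgHom.mapMatrix_apply, Matrix.map_apply, Matrix.updateRow_self]
        refine Finset.sum_eq_zero fun t _ => ?_
        by_cases ht : t = k
        · subst ht; rw [hpfk]; simp
        · rw [Pi.single_eq_of_ne ht]; simp
      rw [this]; exact dvd_zero _
    · have : applyD ((proj a k).mapMatrix (M.updateRow i (Pi.single k 1)) j) (pf β)
          = proj a k (applyD (θ j) (pf β)) := by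
        rw [← hap]
        congr 1
        ext1 t
        simp only [AlgHom.mapMatrix_apply, Matrix.map_apply, Matrix.updateRow_ne hj]
        rfl
      rw [this, hpf]
      simp only
      rw [applyD_form_sub, applyD_form_smul, hg j, map_sub, map_mul (proj a k) (C _) _,
        map_mul (proj a k) (lin a) _, proj_self hk, zero_mul, mul_zero, sub_zero, ← proj_lin]
      exact map_dvd _ (hθ.1 j β hβ'.2)
  choose c hc using hdiv
  have hcproj : ∀ i, proj a k (c i) = c i := by
    intro i
    have h1 := congrArg (proj a k) (hc i)
    rw [proj_proj hk, map_mul, ← hpr, proj_proj hk, hpr, hc i] at h1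
    exact (mul_left_cancel₀ hQR0 h1).symm
  -- the divided derivation
  have hphi : ∀ j, ∃ f, (∑ i, c i • θ i) j = lin a * f := by
    intro j
    apply dvd_of_proj_eq_zero (k := k)
    apply mul_left_cancel₀ hQR0
    rw [mul_zero, Finset.sum_apply, map_sum, Finset.mul_sum]
    have h1 := congrArg (proj a k) (hadj j)
    have h2 : proj a k (if j = k then M.det else 0) = 0 := by
      split_ifs
      · obtain ⟨f, hf⟩ := hadet
        rw [hf, map_mul, proj_self hk, zero_mul]
      · exact map_zero _
    rw [h2, map_sum] at h1
    rw [← h1]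
    refine Finset.sum_congr rfl fun i _ => ?_
    rw [Pi.smul_apply, smul_eq_mul, map_mul, map_mul, hc i, hcproj]
    ring
  choose φ hφ using hphi
  have hφsum : lin a • φ = ∑ i, c i • θ i := by
    ext1 j
    rw [hφ j]; rfl
  have hla := lin_ne_zero ha0
  have hφa : applyD φ a = ∑ i, c i * g i := by
    apply mul_left_cancel₀ hla
    rw [← applyD_smul, hφsum, applyD_sum_smul, Finset.mul_sum]
    refine Finset.sum_congr rfl fun i _ => ?_
    rw [hg i]; ring
  refine ⟨φ, c, hφsum, ?_, hD, ?_, ?_⟩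
  · intro i hci
    have h1 : (M.adjugate k i).IsHomogeneous (∑ j, if j = i then 0 else e j) := by
      rw [Matrix.adjugate_apply]
      apply det_homog
      intro s t
      by_cases hs : s = i
      · subst hs
        rw [Matrix.updateRow_self, if_pos rfl]
        by_cases ht : t = k
        · subst ht; rw [Pi.single_eq_same]; exact isHomogeneous_one _ _
        · rw [Pi.single_eq_of_ne ht]; exact isHomogeneous_zero _ _ _
      · rw [Matrix.updateRow_ne hs, if_neg hs]
        exact he s t
    have h2 := proj_homog a k h1
    rw [hc i] at h2
    obtain ⟨s, hs, hsh⟩ := homog_of_mul hQRh hQR0 h2 hci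
    refine ⟨s, hsh, ?_⟩
    have h3 : ∑ j, e j = (∑ j, if j = i then 0 else e j) + e i := by
      have : ∀ j, e j = (if j = i then 0 else e j) + (if j = i then e j else 0) := by
        intro j; split_ifs <;> simp
      rw [Finset.sum_congr rfl fun j _ => this j, Finset.sum_add_distrib]
      simp
    omega
  · intro β hβ
    have hβ' := Finset.mem_erase.1 hβ
    have h1 : lin β ∣ lin a * applyD φ β := by
      rw [← applyD_smul, hφsum, applyD_sum_smul]
      exact Finset.dvd_sum fun i _ => (hθ.1 i β hβ'.2).mul_left _
    refine ((lin_prime (hA0 β hβ'.2)).dvd_or_dvd h1).resolve_left ?_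
    intro h
    exact hβ'.1 (hinj hβ'.2 ha (hyp_eq_of_lin_dvd ha0 h))
  · have hsplit : ∏ b ∈ A0, lin b =
        lin a * ((∏ b ∈ R, lin b) * ∏ b ∈ (A0.erase a) \ R, lin b) := by
      rw [← Finset.mul_prod_erase A0 _ ha, mul_comm (∏ b ∈ R, lin b), Finset.prod_sdiff hR]
    have h1 : (∑ i, M.adjugate k i * g i) * E =
        C (a k) * ((∏ b ∈ R, lin b) * ∏ b ∈ (A0.erase a) \ R, lin b) := by
      apply mul_left_cancel₀ hla
      calc lin a * ((∑ i, M.adjugate k i * g i) * E)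
          = ((∑ i, M.adjugate k i * g i) * lin a) * E := by ring
        _ = C (a k) * (M.det * E) := by rw [hadja]; ring
        _ = _ := by rw [← hE, hsplit]; ring
    have h2 := congrArg (proj a k) h1
    rw [map_mul, map_sum, map_mul, map_mul, hpr] at h2
    have h3 : (∑ i, c i * proj a k (g i)) * proj a k E =
        proj a k (C (a k)) * proj a k (∏ b ∈ (A0.erase a) \ R, lin b) := by
      apply mul_left_cancel₀ hQR0
      have h4 : ∑ i, proj a k (M.adjugate k i * g i) = QR * ∑ i, c i * proj a k (g i) := by
        rw [Finset.mul_sum]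
        refine Finset.sum_congr rfl fun i _ => ?_
        rw [map_mul, hc i]; ring
      rw [h4] at h2
      linear_combination h2
    have h5 := congrArg (eval x) h3
    simp only [map_mul, map_sum, eval_proj hxa, eval_C, map_prod] at h5
    intro h0
    rw [hφa] at h0
    simp only [map_mul, map_sum] at h0
    rw [h0, zero_mul] at h5
    refine mul_ne_zero hk (Finset.prod_ne_zero_iff.2 fun b hb => ?_) h5.symm
    exact hx b hb


lemma exists_transversal {X Y : Type*} (s : Finset X) (f : X → Y) :
    ∃ R ⊆ s, Set.InjOn f (R : Set X) ∧ ∀ b ∈ s, ∃ r ∈ R, f r = f b := by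
  induction s using Finset.induction_on with
  | empty => exact ⟨∅, by simp, by simp, by simp⟩
  | insert a s _ ih =>
    obtain ⟨R, hRs, hinj, him⟩ := ih
    by_cases h : ∃ b ∈ s, f b = f a
    · refine ⟨R, hRs.trans (Finset.subset_insert _ _), hinj, ?_⟩
      intro b hb
      rcases Finset.mem_insert.1 hb with rfl | hb
      · obtain ⟨b', hb', hbe⟩ := h
        rw [← hbe]; exact him b' hb'
      · exact him b hb
    · refine ⟨insert a R, Finset.insert_subset_insert _ hRs, ?_, ?_⟩
      · rw [Finset.coe_insert, Set.injOn_insert]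
        · refine ⟨hinj, ?_⟩
          rintro ⟨b, hb, hbe⟩
          exact h ⟨b, hRs hb, hbe⟩
        · intro haR
          exact h ⟨a, hRs haR, rfl⟩
      · intro b hb
        rcases Finset.mem_insert.1 hb with rfl | hb
        · exact ⟨b, Finset.mem_insert_self _ _, rfl⟩
        · obtain ⟨r, hr, hre⟩ := him b hb
          exact ⟨r, Finset.mem_insert_of_mem hr, hre⟩

lemma basis_update {A0 : Finset (Fin ℓ → K)} (hA0 : ∀ β ∈ A0, β ≠ 0)
    (hinj : Set.InjOn hyp (A0 : Set (Fin ℓ → K)))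
    {θ : Fin ℓ → Deriv K ℓ} (hθ : IsBasisOf θ (logDer A0)) (c : Fin ℓ → S K ℓ) (i : Fin ℓ)
    (hc : IsUnit (c i)) : IsBasisOf (Function.update θ i (∑ j, c j • θ j)) (logDer A0) := by
  apply saito A0 hA0 hinj
  · intro j
    by_cases hj : j = i
    · subst hj
      rw [Function.update_self]
      exact Submodule.sum_mem _ fun k _ => Submodule.smul_mem _ _ (hθ.1 k)
    · rw [Function.update_of_ne hj]; exact hθ.1 j
  · have h1 : (Matrix.of (Function.update θ i (∑ j, c j • θ j))).det =
        c i • (Matrix.of θ).det := Matrix.det_updateRow_sum (Matrix.of θ) i c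
    rw [h1, smul_eq_mul, hc.mul_left_dvd]
    exact basis_det_dvd hA0 hθ

lemma euler_eq {θ : Fin ℓ → Deriv K ℓ} {A0 : Finset (Fin ℓ → K)} (hθ : IsBasisOf θ (logDer A0))
    {e : Fin ℓ → ℕ} (he : ∀ i, IsHomog (θ i) (e i)) (i0 : Fin ℓ) (h0 : e i0 = 1)
    (h1 : ∀ i, i ≠ i0 → 1 < e i) : ∃ a : K, a ≠ 0 ∧ eulerD K ℓ = (C a : S K ℓ) • θ i0 := by
  have hE : eulerD K ℓ ∈ Submodule.span (S K ℓ) (Set.range θ) := by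
    rw [hθ.2.2]
    intro α _
    rw [applyD_euler]
  obtain ⟨c, hc⟩ := (Submodule.mem_span_range_iff_exists_fun _).1 hE
  have key : eulerD K ℓ = (C (coeff 0 (c i0)) : S K ℓ) • θ i0 := by
    ext1 j
    have h2 := congrArg (homogeneousComponent 1) (congrFun hc j)
    have h3 : homogeneousComponent 1 (eulerD K ℓ j) = eulerD K ℓ j :=
      homogeneousComponent_eq_self (isHomogeneous_X _ _)
    rw [h3] at h2
    rw [← h2, Finset.sum_apply, map_sum, Finset.sum_eq_single i0]
    · rw [Pi.smul_apply, smul_eq_mul, mul_comm, hc_mul (he i0 j), h0, if_pos le_rfl, Nat.sub_self,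
        homogeneousComponent_zero, Pi.smul_apply, smul_eq_mul, mul_comm]
    · intro i _ hi
      rw [Pi.smul_apply, smul_eq_mul, mul_comm, hc_mul (he i j), if_neg]
      have := h1 i hi
      omega
    · simp
  refine ⟨_, ?_, key⟩
  intro hz
  rw [hz, map_zero, zero_smul] at key
  exact X_ne_zero i0 (congrFun key i0)

lemma finrank_inf_hyp (α : ℕ → Fin ℓ → K) (s : Finset ℕ) :
    ℓ ≤ finrank K (s.inf (fun j => hyp (α j)) : Submodule K (Fin ℓ → K)) + s.card := by
  induction s using Finset.induction_on with
  | empty => rw [Finset.inf_empty, finrank_top, Module.finrank_fin_fun]; simp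
  | insert a s ha ih =>
    rw [Finset.inf_insert, Finset.card_insert_of_notMem ha]
    have h1 := Submodule.finrank_sup_add_finrank_inf_eq (hyp (α a)) (s.inf (fun j => hyp (α j)))
    have h2 := Submodule.finrank_le (hyp (α a) ⊔ (s.inf (fun j => hyp (α j))))
    rw [Module.finrank_fin_fun] at h2
    have h3 : ℓ ≤ finrank K (hyp (α a)) + 1 := by
      have := LinearMap.finrank_range_add_finrank_ker
        (∑ i, α a i • LinearMap.proj i : (Fin ℓ → K) →ₗ[K] K)
      rw [Module.finrank_fin_fun] at this
      have h4 := Submodule.finrank_le (LinearMap.range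
        (∑ i, α a i • LinearMap.proj i : (Fin ℓ → K) →ₗ[K] K))
      rw [Module.finrank_self] at h4
      unfold hyp
      omega
    omega

/-- Existence of the adapted basis. -/
lemma adapted_basis (A : Finset (Fin ℓ → K))
    (hA0 : ∀ α ∈ A, α ≠ 0)
    (d : ℕ → ℕ) (hd1 : d 1 = 1)
    (hmono : ∀ i j, 1 ≤ i → i ≤ j → j ≤ ℓ → d i ≤ d j) (hd2 : 1 < d 2)
    (hfree : IsFreeWithExp A (fun i => d ((i : ℕ) + 1)))
    (q : ℕ) (hq2 : 2 ≤ q) (hqℓ : q ≤ ℓ)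
    (α : ℕ → (Fin ℓ → K)) (hαA : ∀ j ∈ Finset.Icc 2 q, α j ∈ A)
    (A' : Finset (Fin ℓ → K)) (hA' : A' = A \ (Finset.Icc 2 q).image α)
    (h1 : ∀ j ∈ Finset.Icc 2 q, A.card = (restH (A.erase (α j)) (α j)).card + d j)
    (Xs : Submodule K (Fin ℓ → K)) (hXs : Xs = (Finset.Icc 2 q).inf (fun j => hyp (α j)))
    (h2 : codim Xs = q - 1)
    (h3 : ¬ (Xs : Set (Fin ℓ → K)) ⊆ ⋃ β ∈ A', (hyp β : Set (Fin ℓ → K))) :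
    ∃ (θ : Fin ℓ → Deriv K ℓ) (η : ℕ → Deriv K ℓ), IsBasisOf θ (logDer A) ∧
      (∀ i, IsHomog (θ i) (d ((i : ℕ) + 1))) ∧
      (∀ i : Fin ℓ, (i : ℕ) = 0 → θ i = eulerD K ℓ) ∧
      (∀ i : Fin ℓ, 1 ≤ (i : ℕ) → (i : ℕ) + 1 ≤ q →
        θ i = lin (α ((i : ℕ) + 1)) • η ((i : ℕ) + 1) ∧
        IsHomog (η ((i : ℕ) + 1)) (d ((i : ℕ) + 1) - 1)) := by
  have hℓ : 0 < ℓ := by omega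
  have hcard : (Finset.Icc 2 q).card = q - 1 := by simp
  -- dual vectors
  have hv : ∀ j ∈ Finset.Icc 2 q, ∃ v : Fin ℓ → K, v ∉ hyp (α j) ∧
      ∀ i ∈ Finset.Icc 2 q, i ≠ j → v ∈ hyp (α i) := by
    intro j hj
    by_contra hc
    push Not at hc
    have hle : ((Finset.Icc 2 q).erase j).inf (fun j => hyp (α j)) ≤ hyp (α j) := by
      intro v hv
      by_contra hvj
      obtain ⟨i, hi, hij, hvi⟩ := hc v hvj
      exact hvi ((Finset.inf_le (f := fun j => hyp (α j)) (Finset.mem_erase.2 ⟨hij, hi⟩)) hv)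
    have hX : Xs = ((Finset.Icc 2 q).erase j).inf (fun j => hyp (α j)) := by
      rw [hXs]
      conv_lhs => rw [← Finset.insert_erase hj]
      rw [Finset.inf_insert]
      exact inf_eq_right.2 hle
    have := finrank_inf_hyp α ((Finset.Icc 2 q).erase j)
    rw [← hX, Finset.card_erase_of_mem hj, hcard] at this
    unfold codim at h2
    omega
  -- the generic point
  have hx : ∃ x ∈ Xs, x ≠ 0 ∧ ∀ β ∈ A', x ∉ hyp β := by
    rw [Set.not_subset] at h3
    obtain ⟨x, hxX, hx⟩ := h3
    simp only [Set.mem_iUnion, not_exists] at hx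
    by_cases hx0 : x = 0
    · subst hx0
      have hne : Xs ≠ ⊥ := by
        rintro rfl
        unfold codim at h2
        rw [finrank_bot] at h2
        omega
      obtain ⟨y, hy, hy0⟩ := Submodule.exists_mem_ne_zero_of_ne_bot hne
      exact ⟨y, hy, hy0, fun β hβ => absurd (hyp β).zero_mem (hx β hβ)⟩
    · exact ⟨x, hxX, hx0, fun β hβ h => hx β hβ h⟩
  obtain ⟨x, hxX, hx0, hxA⟩ := hx
  have hXle : ∀ j ∈ Finset.Icc 2 q, Xs ≤ hyp (α j) := by
    intro j hj; rw [hXs]; exact Finset.inf_le (f := fun j => hyp (α j)) hj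
  have hF : ∀ β ∈ A, Xs ≤ hyp β → ∃ j ∈ Finset.Icc 2 q, β = α j := by
    intro β hβ hle
    by_contra hc
    push Not at hc
    apply hxA β _ (hle hxX)
    rw [hA', Finset.mem_sdiff, Finset.mem_image]
    refine ⟨hβ, ?_⟩
    rintro ⟨j, hj, rfl⟩
    exact hc j hj rfl
  have hF1 : ∀ i ∈ Finset.Icc 2 q, ∀ β ∈ A, hyp β = hyp (α i) → β = α i := by
    intro i hi β hβ h
    obtain ⟨j, hj, rfl⟩ := hF β hβ (h ▸ hXle i hi)
    by_cases hij : i = j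
    · rw [hij]
    · obtain ⟨v, hv1, hv2⟩ := hv j hj
      exact absurd (h ▸ hv2 i hi hij) hv1
  have hF2 : ∀ k ∈ Finset.Icc 2 q, ∀ i ∈ Finset.Icc 2 q, i ≠ k → ∀ β ∈ A, β ≠ α k →
      hyp (α k) ⊓ hyp β = hyp (α k) ⊓ hyp (α i) → β = α i := by
    intro k hk i hi hik β hβ hβk h
    obtain ⟨j, hj, rfl⟩ := hF β hβ (by
      have : Xs ≤ hyp (α k) ⊓ hyp β := by rw [h]; exact le_inf (hXle k hk) (hXle i hi)
      exact this.trans inf_le_right)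
    by_cases hij : i = j
    · rw [hij]
    · obtain ⟨v, hv1, hv2⟩ := hv j hj
      have hkj : k ≠ j := by rintro rfl; exact hβk rfl
      have : v ∈ hyp (α k) ⊓ hyp (α j) := by
        rw [h]; exact ⟨hv2 k hk hkj, hv2 i hi hij⟩
      exact absurd this.2 hv1
  have hαinj : ∀ i ∈ Finset.Icc 2 q, ∀ j ∈ Finset.Icc 2 q, i ≠ j → α i ≠ α j := by
    intro i hi j hj hij h
    obtain ⟨v, hv1, hv2⟩ := hv j hj
    exact hv1 (h ▸ hv2 i hi hij)
  -- reduced arrangement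
  obtain ⟨A0, hA0A, hA0inj, hA0im⟩ := exists_transversal A (hyp (K := K) (ℓ := ℓ))
  have hA00 : ∀ β ∈ A0, β ≠ 0 := fun β hβ => hA0 β (hA0A hβ)
  have hrep : ∀ β ∈ A, ∃ β0 ∈ A0, hyp β0 = hyp β := hA0im
  have hαA0 : ∀ j ∈ Finset.Icc 2 q, α j ∈ A0 := by
    intro j hj
    obtain ⟨β0, hβ0, h⟩ := hrep _ (hαA j hj)
    rwa [← hF1 j hj β0 (hA0A hβ0) h]
  have hlog : logDer A = logDer A0 := by
    apply le_antisymm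
    · intro θ hθ β hβ
      exact hθ β (hA0A hβ)
    · intro θ hθ β hβ
      obtain ⟨β0, hβ0, h⟩ := hrep β hβ
      obtain ⟨c, hc, rfl⟩ := eq_smul_of_hyp_le (hA0 β hβ) h.le
      rw [lin_smul, applyD_form_smul]
      exact mul_dvd_mul_left _ (hθ β0 hβ0)
  -- transversals of the restrictions
  have hRex : ∀ k ∈ Finset.Icc 2 q, ∃ R ⊆ A0.erase (α k),
      Set.InjOn (fun β => hyp (α k) ⊓ hyp β) (R : Set (Fin ℓ → K)) ∧
      A.card = R.card + d k ∧ ∀ β ∈ (A0.erase (α k)) \ R, eval x (lin β) ≠ 0 := by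
    intro k hk
    obtain ⟨R, hR, hRi, hRim⟩ := exists_transversal (A0.erase (α k))
      (fun β => hyp (α k) ⊓ hyp β)
    refine ⟨R, hR, hRi, ?_, ?_⟩
    · rw [h1 k hk, ← Finset.card_image_of_injOn hRi]
      congr 2
      unfold restH
      ext Y
      simp only [Finset.mem_image, Finset.mem_erase]
      constructor
      · rintro ⟨β, ⟨hβk, hβ⟩, rfl⟩
        obtain ⟨β0, hβ0, h⟩ := hrep β hβ
        have hne : β0 ≠ α k := by
          rintro rfl
          exact hβk (hF1 k hk β hβ h.symm)
        obtain ⟨r, hr, hre⟩ := hRim β0 (Finset.mem_erase.2 ⟨hne, hβ0⟩)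
        exact ⟨r, hr, by rw [← h]; exact hre⟩
      · rintro ⟨β, hβ, rfl⟩
        have hb := Finset.mem_erase.1 (hR hβ)
        exact ⟨β, ⟨hb.1, hA0A hb.2⟩, rfl⟩
    · intro β hβ h0
      rw [Finset.mem_sdiff, Finset.mem_erase] at hβ
      obtain ⟨⟨hβk, hβA⟩, hβR⟩ := hβ
      by_cases hβA' : β ∈ A'
      · exact hxA β hβA' ((mem_hyp' _ _).2 h0)
      · have : ∃ i ∈ Finset.Icc 2 q, α i = β := by
          by_contra hc
          apply hβA'
          rw [hA', Finset.mem_sdiff, Finset.mem_image]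
          exact ⟨hA0A hβA, hc⟩
        obtain ⟨i, hi, rfl⟩ := this
        have hik : i ≠ k := by rintro rfl; exact hβk rfl
        obtain ⟨β', hβ', h⟩ := hRim (α i) (Finset.mem_erase.2 ⟨hβk, hβA⟩)
        have hb := Finset.mem_erase.1 (hR hβ')
        exact hβR (hF2 k hk i hi hik β' (hA0A hb.2) hb.1 h ▸ hβ')
  have hxα : ∀ j ∈ Finset.Icc 2 q, eval x (lin (α j)) = 0 := fun j hj =>
    (mem_hyp' _ _).1 (hXle j hj hxX)
  rw [hlog]
  have hcardle : A0.card ≤ A.card := Finset.card_le_card hA0A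
  -- the induction
  have main : ∀ k, 1 ≤ k → k ≤ q → ∃ (θ : Fin ℓ → Deriv K ℓ) (η : ℕ → Deriv K ℓ),
      IsBasisOf θ (logDer A0) ∧
      (∀ i, IsHomog (θ i) (d ((i : ℕ) + 1))) ∧
      (∀ i : Fin ℓ, (i : ℕ) = 0 → θ i = eulerD K ℓ) ∧
      (∀ i : Fin ℓ, 1 ≤ (i : ℕ) → (i : ℕ) + 1 ≤ k →
        θ i = lin (α ((i : ℕ) + 1)) • η ((i : ℕ) + 1) ∧
        IsHomog (η ((i : ℕ) + 1)) (d ((i : ℕ) + 1) - 1) ∧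
        η ((i : ℕ) + 1) ∈ logDer (A0.erase (α ((i : ℕ) + 1)))) := by
    intro k hk1
    induction k, hk1 using Nat.le_induction with
    | base =>
      intro _
      obtain ⟨θ, hθ, hhom⟩ := hfree
      rw [hlog] at hθ
      obtain ⟨a, ha, hE⟩ := euler_eq hθ hhom ⟨0, hℓ⟩ (by simpa using hd1) (by
        intro i hi
        have hi0 : (i : ℕ) ≠ 0 := fun h => hi (Fin.ext h)
        have := hmono 2 (i + 1) (by omega) (by omega) (by omega)
        exact lt_of_lt_of_le hd2 this)
      have hsum : ∑ j, (Pi.single (⟨0, hℓ⟩ : Fin ℓ) (C a) : Fin ℓ → S K ℓ) j • θ j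
          = eulerD K ℓ := by
        rw [Finset.sum_eq_single (⟨0, hℓ⟩ : Fin ℓ)]
        · rw [Pi.single_eq_same, hE]
        · intro j _ hj; rw [Pi.single_eq_of_ne hj, zero_smul]
        · simp
      have hb := basis_update hA00 hA0inj hθ (Pi.single (⟨0, hℓ⟩ : Fin ℓ) (C a)) ⟨0, hℓ⟩ (by
        rw [Pi.single_eq_same]; exact (isUnit_iff_ne_zero.2 ha).map C)
      rw [hsum] at hb
      refine ⟨_, fun _ => 0, hb, ?_, ?_, ?_⟩
      · intro i
        by_cases hi : i = ⟨0, hℓ⟩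
        · subst hi
          rw [Function.update_self]
          intro j
          simp only [zero_add, hd1]
          exact isHomogeneous_X _ _
        · rw [Function.update_of_ne hi]; exact hhom i
      · intro i hi
        have : i = ⟨0, hℓ⟩ := Fin.ext hi
        rw [this, Function.update_self]
      · intro i hi hi'
        omega
    | succ k hk ih =>
      intro hkq
      obtain ⟨θ, η, hθ, hhom, hθ0, hθη⟩ := ih (by omega)
      have hkI : k + 1 ∈ Finset.Icc 2 q := by simp; omega
      obtain ⟨R, hR, hRi, hRc, hRx⟩ := hRex (k + 1) hkI
      obtain ⟨φ, c, hφ, hcs, hD, hφl, hφx⟩ := step hA00 hA0inj (hαA0 _ hkI) hR hRi hθ hhom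
        (hxα _ hkI) hRx
      have hkℓ : k < ℓ := by omega
      -- existence of a pivot
      have hpiv : ∃ i : Fin ℓ, k ≤ (i : ℕ) ∧ c i ≠ 0 := by
        by_contra hc
        push Not at hc
        -- evaluate at x
        have hev : ∀ j, eval x (c ⟨0, hℓ⟩) * x j = 0 := by
          intro j
          have h4 := congrArg (eval x) (congrFun hφ j)
          rw [Pi.smul_apply, smul_eq_mul, map_mul, hxα _ hkI, zero_mul, Finset.sum_apply, map_sum,
            Finset.sum_eq_single (⟨0, hℓ⟩ : Fin ℓ)] at h4
          · rw [Pi.smul_apply, smul_eq_mul, map_mul, hθ0 _ rfl] at h4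
            simpa [eulerD] using h4.symm
          · intro i _ hi
            have hi0 : (i : ℕ) ≠ 0 := fun h => hi (Fin.ext h)
            rw [Pi.smul_apply, smul_eq_mul]
            by_cases hik : k ≤ (i : ℕ)
            · rw [hc i hik, zero_mul, map_zero]
            · rw [(hθη i (by omega) (by omega)).1, Pi.smul_apply, smul_eq_mul, map_mul, map_mul,
                hxα _ (by simp; omega)]
              ring
          · simp
        have hc0 : eval x (c ⟨0, hℓ⟩) = 0 := by
          obtain ⟨j, hj⟩ := exists_coord_ne hx0
          exact (mul_eq_zero.1 (hev j)).resolve_right hj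
        -- apply to the form
        have hq' : ∀ i : Fin ℓ, ∃ f, c i * applyD (θ i) (α (k + 1)) = lin (α (k + 1)) * f ∧
            eval x f = 0 := by
          intro i
          by_cases hi0 : (i : ℕ) = 0
          · have : i = ⟨0, hℓ⟩ := Fin.ext hi0
            subst this
            refine ⟨c ⟨0, hℓ⟩, ?_, hc0⟩
            rw [hθ0 _ rfl, applyD_euler, mul_comm]
          by_cases hik : k ≤ (i : ℕ)
          · exact ⟨0, by rw [hc i hik, zero_mul, mul_zero], map_zero _⟩
          · obtain ⟨e1, -, e3⟩ := hθη i (by omega) (by omega)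
            have hiI : (i : ℕ) + 1 ∈ Finset.Icc 2 q := by simp; omega
            obtain ⟨f, hf⟩ := e3 (α (k + 1)) (Finset.mem_erase.2
              ⟨hαinj _ hkI _ hiI (by omega), hαA0 _ hkI⟩)
            refine ⟨c i * lin (α ((i : ℕ) + 1)) * f, ?_, ?_⟩
            · rw [e1, applyD_smul, hf]; ring
            · rw [map_mul, map_mul, hxα _ hiI]; ring
        choose f hf hfx using hq'
        apply hφx
        have h5 : applyD φ (α (k + 1)) = ∑ i, f i := by
          apply mul_left_cancel₀ (lin_ne_zero (hA00 _ (hαA0 _ hkI)))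
          rw [← applyD_smul, hφ, applyD_sum_smul, Finset.mul_sum]
          exact Finset.sum_congr rfl fun i _ => hf i
        rw [h5, map_sum]
        exact Finset.sum_eq_zero fun i _ => hfx i
      obtain ⟨i, hik, hci⟩ := hpiv
      obtain ⟨s, hs, hse⟩ := hcs i hci
      have hdi := hmono (k + 1) (i + 1) (by omega) (by omega) (by omega)
      have hs0 : s = 0 := by omega
      have hdd : d ((i : ℕ) + 1) = d (k + 1) := by omega
      have hDe : ∑ j : Fin ℓ, d ((j : ℕ) + 1) = R.card + d (k + 1) := by omega
      subst hs0
      have hu : IsUnit (c i) := by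
        have h6 := (totalDegree_zero_iff_isHomogeneous (Fin ℓ)).2 hs
        rw [totalDegree_eq_zero_iff_eq_C] at h6
        rw [h6]
        refine (isUnit_iff_ne_zero.2 ?_).map C
        intro h7
        rw [h7, map_zero] at h6
        exact hci h6
      have hb := basis_update hA00 hA0inj hθ c i hu
      rw [← hφ] at hb
      have hwh : IsHomog (lin (α (k + 1)) • φ) (d (k + 1)) := by
        intro j
        rw [hφ, Finset.sum_apply]
        refine IsHomogeneous.sum _ _ _ fun t _ => ?_
        rw [Pi.smul_apply, smul_eq_mul]
        by_cases hct : c t = 0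
        · rw [hct, zero_mul]; exact isHomogeneous_zero _ _ _
        · obtain ⟨s, hs, hse⟩ := hcs t hct
          have : d (k + 1) = s + d ((t : ℕ) + 1) := by omega
          rw [this]
          exact hs.mul (hhom t j)
      have hφh : IsHomog φ (d (k + 1) - 1) := by
        intro j
        by_cases hj : φ j = 0
        · rw [hj]; exact isHomogeneous_zero _ _ _
        · obtain ⟨s, hs, hsh⟩ := homog_of_mul (lin_homog _)
            (lin_ne_zero (hA00 _ (hαA0 _ hkI))) (hwh j) hj
          have : d (k + 1) - 1 = s := by omega
          rw [this]; exact hsh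
      set k0 : Fin ℓ := ⟨k, hkℓ⟩ with hk0
      set w := lin (α (k + 1)) • φ with hw
      refine ⟨Function.update θ i w ∘ Equiv.swap k0 i, Function.update η (k + 1) φ, ?_, ?_, ?_, ?_⟩
      · apply isBasisOf_reindex (Equiv.swap k0 i)
        convert hb using 1
        ext1 j
        simp
      · intro j
        simp only [Function.comp_apply]
        by_cases hj : j = k0
        · subst hj
          rw [Equiv.swap_apply_left, Function.update_self]
          exact hwh
        · by_cases hji : j = i
          · subst hji
            rw [Equiv.swap_apply_right, Function.update_of_ne (Ne.symm hj), hdd]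
            exact hhom k0
          · rw [Equiv.swap_apply_of_ne_of_ne hj hji, Function.update_of_ne hji]
            exact hhom j
      · intro j hj
        have hjk : j ≠ k0 := by rintro rfl; simp [hk0] at hj; omega
        have hji : j ≠ i := by rintro rfl; omega
        simp only [Function.comp_apply]
        rw [Equiv.swap_apply_of_ne_of_ne hjk hji, Function.update_of_ne hji]
        exact hθ0 j hj
      · intro j hj1 hj2
        simp only [Function.comp_apply]
        by_cases hjk : j = k0
        · subst hjk
          rw [Equiv.swap_apply_left, Function.update_self]
          simp only [hk0, Function.update_self]
          exact ⟨hw, hφh, hφl⟩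
        · have hjk' : (j : ℕ) ≠ k := fun h => hjk (Fin.ext h)
          have hji : j ≠ i := by rintro rfl; omega
          rw [Equiv.swap_apply_of_ne_of_ne hjk hji, Function.update_of_ne hji,
            Function.update_of_ne (by omega)]
          exact hθη j hj1 (by omega)
  obtain ⟨θ, η, g1, g2, g3, g4⟩ := main q (by omega) le_rfl
  exact ⟨θ, η, g1, g2, g3, fun i hi hi' => ⟨(g4 i hi hi').1, (g4 i hi hi').2.1⟩⟩

end ArrPaper

open ArrPaper in
/-- MRT from MDT: under the MDT hypotheses, the restriction
`𝒜^{X_I}` is free with basis the restrictions onto `X_I` of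
`θ_E, {αᵢηᵢ}_{i ∉ I}, θ_{q+1}, …, θ_ℓ`. -/
theorem stmt18 {K : Type*} [Field K] {ℓ : ℕ} (A : Finset (Fin ℓ → K))
    (hA0 : ∀ α ∈ A, α ≠ 0)
    (d : ℕ → ℕ) (hd1 : d 1 = 1)
    (hmono : ∀ i j, 1 ≤ i → i ≤ j → j ≤ ℓ → d i ≤ d j) (hd2 : 1 < d 2)
    (hfree : IsFreeWithExp A (fun i => d ((i : ℕ) + 1)))
    (q : ℕ) (hq2 : 2 ≤ q) (hqℓ : q ≤ ℓ)
    (α : ℕ → (Fin ℓ → K)) (hαA : ∀ j ∈ Finset.Icc 2 q, α j ∈ A)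
    (A' : Finset (Fin ℓ → K)) (hA' : A' = A \ (Finset.Icc 2 q).image α)
    (h1 : ∀ j ∈ Finset.Icc 2 q, A.card = (restH (A.erase (α j)) (α j)).card + d j)
    (Xs : Submodule K (Fin ℓ → K)) (hXs : Xs = (Finset.Icc 2 q).inf (fun j => hyp (α j)))
    (h2 : codim Xs = q - 1)
    (h3 : ¬ (Xs : Set (Fin ℓ → K)) ⊆ ⋃ β ∈ A', (hyp β : Set (Fin ℓ → K))) :
    ∃ η θ : ℕ → Deriv K ℓ,
      (∀ j ∈ Finset.Icc 2 q, IsHomog (η j) (d j - 1)) ∧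
      (∀ j ∈ Finset.Icc (q+1) ℓ, IsHomog (θ j) (d j)) ∧
      IsBasisOf (fun i : Fin ℓ =>
        if (i : ℕ) = 0 then eulerD K ℓ
        else if (i : ℕ) + 1 ≤ q then lin (α ((i : ℕ) + 1)) • η ((i : ℕ) + 1)
        else θ ((i : ℕ) + 1)) (logDer A) ∧
      ∀ I ⊆ Finset.Icc 2 q,
        ∀ (ψ : (Fin (ℓ - I.card) → K) ≃ₗ[K] ↥((I.inf (fun j => hyp (α j)) : Submodule K (Fin ℓ → K))))
          (γ : Fin (ℓ - I.card) → (Fin ℓ → K)),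
          CoordLifts ((I.inf (fun j => hyp (α j))).subtype ∘ₗ ψ.toLinearMap) γ →
          ∀ B : Finset (Fin (ℓ - I.card) → K),
            Represents B ((I.inf (fun j => hyp (α j))).subtype ∘ₗ ψ.toLinearMap) A
              (I.inf (fun j => hyp (α j))) →
            IsBasisOf
              (Sum.elim
                (fun _ : Unit =>
                  restD ((I.inf (fun j => hyp (α j))).subtype ∘ₗ ψ.toLinearMap) γ
                    (eulerD K ℓ))
                (Sum.elim
                  (fun j : {j : ℕ // j ∈ Finset.Icc 2 q \ I} =>
                    restD ((I.inf (fun j => hyp (α j))).subtype ∘ₗ ψ.toLinearMap) γ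
                      (lin (α j.1) • η j.1))
                  (fun j : {j : ℕ // j ∈ Finset.Icc (q+1) ℓ} =>
                    restD ((I.inf (fun j => hyp (α j))).subtype ∘ₗ ψ.toLinearMap) γ
                      (θ j.1))))
              (logDer B) := by
  obtain ⟨θf, η, hb, hhom, hE, hη⟩ := adapted_basis A hA0 d hd1 hmono hd2 hfree q hq2 hqℓ α hαA A'
    hA' h1 Xs hXs h2 h3
  have hθval : ∀ i : Fin ℓ, (fun j : ℕ => if h : j - 1 < ℓ then θf ⟨j - 1, h⟩ else 0)
      ((i : ℕ) + 1) = θf i := by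
    intro i
    simp
  refine ⟨η, fun j => if h : j - 1 < ℓ then θf ⟨j - 1, h⟩ else 0, ?_, ?_, ?_, ?_⟩
  · intro j hj
    rw [Finset.mem_Icc] at hj
    have := (hη ⟨j - 1, by omega⟩ (by simp only; omega) (by simp only; omega)).2
    have hj1 : j - 1 + 1 = j := by omega
    simpa only [hj1] using this
  · intro j hj
    rw [Finset.mem_Icc] at hj
    have hj1 : j - 1 + 1 = j := by omega
    have hlt : j - 1 < ℓ := by omega
    have := hhom ⟨j - 1, hlt⟩
    simp only [hj1] at this
    simpa only [dif_pos hlt] using this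
  · convert hb using 1
    funext i
    by_cases hi0 : (i : ℕ) = 0
    · rw [if_pos hi0, hE i hi0]
    · rw [if_neg hi0]
      by_cases hiq : (i : ℕ) + 1 ≤ q
      · rw [if_pos hiq, (hη i (by omega) hiq).1]
      · rw [if_neg hiq, hθval i]
  · intro I hI ψ γ hγ B hB
    have hmem : ∀ i, θf i ∈ logDer A := hb.1
    have hIcard : I.card ≤ q - 1 := by
      have := Finset.card_le_card hI
      simpa using this
    refine restr_main (A := A) (I := I) (α := α) (fun i hi => hαA i (hI hi)) ?_ ?_ hγ B hB ?_ _ ?_ ?_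
    · intro a b hab
      exact ψ.injective (Subtype.ext hab)
    · rw [LinearMap.range_comp, LinearEquiv.range, Submodule.map_top, Submodule.range_subtype]
    · rw [Fintype.card_sum, Fintype.card_sum, Fintype.card_coe, Fintype.card_coe,
        Finset.card_sdiff_of_subset hI, Fintype.card_unit, Nat.card_Icc, Nat.card_Icc]
      omega
    · rintro (_ | ⟨j, hj⟩ | ⟨j, hj⟩)
      · refine ⟨eulerD K ℓ, ?_, rfl⟩
        rw [← hE ⟨0, by omega⟩ rfl]
        exact hmem _
      · have hj' := Finset.mem_Icc.1 (Finset.mem_sdiff.1 hj).1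
        refine ⟨lin (α j) • η j, ?_, rfl⟩
        have h5 := (hη ⟨j - 1, by omega⟩ (by simp only; omega) (by simp only; omega)).1
        have hj1 : j - 1 + 1 = j := by omega
        simp only [hj1] at h5
        rw [← h5]
        exact hmem _
      · have hj' := Finset.mem_Icc.1 hj
        refine ⟨_, ?_, rfl⟩
        have hlt : j - 1 < ℓ := by omega
        simp only [dif_pos hlt]
        exact hmem _
    · intro θ hθ
      rw [← hb.2.2] at hθ
      induction hθ using Submodule.span_induction with
      | zero => rw [restD_zero]; exact Submodule.zero_mem _
      | add a b _ _ ha hb' => rw [restD_add]; exact Submodule.add_mem _ ha hb'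
      | smul f a _ ha => rw [restD_smul]; exact Submodule.smul_mem _ _ ha
      | mem a ha =>
        obtain ⟨i, rfl⟩ := ha
        by_cases hi0 : (i : ℕ) = 0
        · rw [hE i hi0]
          exact Submodule.subset_span ⟨Sum.inl (), rfl⟩
        by_cases hiq : (i : ℕ) + 1 ≤ q
        · rw [(hη i (by omega) hiq).1]
          by_cases hiI : (i : ℕ) + 1 ∈ I
          · rw [restD_smul, pullback_lin, pullback_lin_zero,
              show lin (0 : Fin (ℓ - I.card) → K) = 0 by simp [lin], zero_smul]
            · exact Submodule.zero_mem _
            · rw [LinearMap.range_comp, LinearEquiv.range, Submodule.map_top,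
                Submodule.range_subtype]
              exact Finset.inf_le (f := fun j => hyp (α j)) hiI
          · refine Submodule.subset_span ⟨Sum.inr (Sum.inl ⟨(i : ℕ) + 1, ?_⟩), rfl⟩
            rw [Finset.mem_sdiff, Finset.mem_Icc]
            exact ⟨by omega, hiI⟩
        · refine Submodule.subset_span ⟨Sum.inr (Sum.inr ⟨(i : ℕ) + 1, ?_⟩), ?_⟩
          · rw [Finset.mem_Icc]
            have := i.2
            omega
          · simp only [Sum.elim_inr]
            exact congrArg _ (hθval i)
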